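/- arXiv:2502.11467 — 2 statements merged into one kernel-verified Lean document; each statement's English description precedes it below -/
import Mathlib

section
/- Let d, n, s ∈ ℕ₊ and let f be a column-symmetric polynomial of degree s in the d·n variables x_{ij} (1 ≤ i ≤ d, 1 ≤ j ≤ n) all of whose coefficients are positive and which satisfies max_{X ∈ [0,1]^{d×n}} |f(X)| ≤ 1. Then for every N, L ∈ ℕ₊ there exists a Transformer network TF of width d' at most 12·(2d)^s·N and depth at most 2sL + 3s, each of whose attention layers has a single head (h = 1), such that for every X ∈ [0,1]^{d×n}, embedding X as the top-left block of a matrix in ℝ^{d'×(n+1)} whose remaining entries are zero, a fixed designated entry of the output matrix (depending only on d, n, s, N, L, f and not on X) satisfies |f(X) − TF(X)| < 8^s · N^{−L}. -/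
open scoped Matrix

/-- Entrywise ReLU. -/
def relu (x : ℝ) : ℝ := max 0 x

/-- Entrywise ReLU on matrices. -/
def reluM {a b : ℕ} (X : Matrix (Fin a) (Fin b) ℝ) : Matrix (Fin a) (Fin b) ℝ :=
  Matrix.of fun i j => relu (X i j)

/-- Column-wise softmax: entry `(i,j)` is `exp(−A_{ij}) / Σ_l exp(−A_{lj})`. -/
noncomputable def softmax {n : ℕ} (A : Matrix (Fin n) (Fin n) ℝ) :
    Matrix (Fin n) (Fin n) ℝ :=
  Matrix.of fun i j => Real.exp (-(A i j)) / ∑ l, Real.exp (-(A l j))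

/-- The parameters of an attention layer on `ℝ^{d×·}` with `h` heads and inner
dimension `m`. -/
structure AttnLayer (d : ℕ) where
  m : ℕ
  h : ℕ
  WO : Fin h → Matrix (Fin d) (Fin m) ℝ
  WV : Fin h → Matrix (Fin m) (Fin d) ℝ
  WK : Fin h → Matrix (Fin m) (Fin d) ℝ
  WQ : Fin h → Matrix (Fin m) (Fin d) ℝ

/-- `Attn(X) = X + Σ_i WO^i WV^i X · softmax((WK^i X)^⊤ WQ^i X)`. -/
noncomputable def AttnLayer.apply {d : ℕ} (A : AttnLayer d) {n : ℕ}
    (X : Matrix (Fin d) (Fin n) ℝ) : Matrix (Fin d) (Fin n) ℝ :=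
  X + ∑ i, A.WO i * (A.WV i * X * softmax ((A.WK i * X)ᵀ * (A.WQ i * X)))

/-- The parameters of a feed-forward layer on `ℝ^{d×·}` with inner dimension `r`. -/
structure FFLayer (d : ℕ) where
  r : ℕ
  W1 : Matrix (Fin r) (Fin d) ℝ
  W2 : Matrix (Fin d) (Fin r) ℝ
  b1 : Fin r → ℝ
  b2 : Fin d → ℝ

/-- `FF(X) = X + W₂ · ReLU(W₁ X + b₁ 1ₙ^⊤) + b₂ 1ₙ^⊤`. -/
def FFLayer.apply {d : ℕ} (F : FFLayer d) {n : ℕ}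
    (X : Matrix (Fin d) (Fin n) ℝ) : Matrix (Fin d) (Fin n) ℝ :=
  X + F.W2 * reluM (F.W1 * X + Matrix.of fun i _ => F.b1 i) +
    Matrix.of fun i _ => F.b2 i

/-- A Transformer block `TB = FF ∘ Attn`. -/
structure TransformerBlock (d : ℕ) where
  attn : AttnLayer d
  ff : FFLayer d

/-- Applying a Transformer block: `TB(X) = FF(Attn(X))`. -/
noncomputable def TransformerBlock.apply {d : ℕ} (B : TransformerBlock d) {n : ℕ}
    (X : Matrix (Fin d) (Fin n) ℝ) : Matrix (Fin d) (Fin n) ℝ :=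
  B.ff.apply (B.attn.apply X)

/-- Applying a Transformer network (a composition of Transformer blocks). -/
noncomputable def applyNet {d : ℕ} (net : List (TransformerBlock d)) {n : ℕ}
    (X : Matrix (Fin d) (Fin n) ℝ) : Matrix (Fin d) (Fin n) ℝ :=
  net.foldl (fun Y B => B.apply Y) X

/-- Embed a `d × n` matrix into the top-left block of a `d' × n'` matrix,
filling the remaining entries with zeros. -/
def embed {d n : ℕ} (d' n' : ℕ) (X : Matrix (Fin d) (Fin n) ℝ) :
    Matrix (Fin d') (Fin n') ℝ :=
  Matrix.of fun i j =>
    if h : (i : ℕ) < d ∧ (j : ℕ) < n then X ⟨i, h.1⟩ ⟨j, h.2⟩ else 0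

/-- A polynomial in the variables `x_{ij}` is column-symmetric if it is invariant
under every permutation of the column indices. -/
def ColSym {d n : ℕ} (f : MvPolynomial (Fin d × Fin n) ℝ) : Prop :=
  ∀ σ : Equiv.Perm (Fin n),
    MvPolynomial.rename (Equiv.prodCongr (Equiv.refl (Fin d)) σ) f = f


namespace SymTransformer

variable {ι κ μ I P : Type}

/-- The action of a feed-forward layer on a single column. -/
def col {D : ℕ} (F : FFLayer D) (y : Fin D → ℝ) : Fin D → ℝ :=
  y + F.W2 *ᵥ (fun p => relu ((F.W1 *ᵥ y) p + F.b1 p)) + F.b2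

/-- The action of a composition of feed-forward layers on a single column. -/
def runCol {D : ℕ} (l : List (FFLayer D)) (y : Fin D → ℝ) : Fin D → ℝ :=
  l.foldl (fun y F => col F y) y

theorem apply_col {D n : ℕ} (F : FFLayer D) (X : Matrix (Fin D) (Fin n) ℝ) (j : Fin n) :
    (fun i => F.apply X i j) = col F (fun i => X i j) := by
  funext i
  simp [FFLayer.apply, col, Matrix.mul_apply, reluM, Matrix.mulVec, dotProduct]

/-- Affine real functions of finitely many real variables. -/
def IsAffine [Fintype ι] (h : (ι → ℝ) → ℝ) : Prop :=
  ∃ (c : ι → ℝ) (b : ℝ), ∀ x, h x = c ⬝ᵥ x + b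

namespace IsAffine

variable [Fintype ι]

theorem const (b : ℝ) : IsAffine (fun _ : ι → ℝ => b) := ⟨0, b, by simp⟩

theorem proj [DecidableEq ι] (a : ι) : IsAffine (fun x : ι → ℝ => x a) :=
  ⟨Pi.single a 1, 0, by simp⟩

theorem add {f g : (ι → ℝ) → ℝ} (hf : IsAffine f) (hg : IsAffine g) :
    IsAffine (fun x => f x + g x) := by
  obtain ⟨c, b, h⟩ := hf
  obtain ⟨c', b', h'⟩ := hg
  exact ⟨c + c', b + b', fun x => by dsimp only; rw [h, h', add_dotProduct]; ring⟩

theorem const_mul {f : (ι → ℝ) → ℝ} (hf : IsAffine f) (r : ℝ) :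
    IsAffine (fun x => r * f x) := by
  obtain ⟨c, b, h⟩ := hf
  exact ⟨r • c, r * b, fun x => by dsimp only; rw [h, smul_dotProduct, smul_eq_mul]; ring⟩

theorem sub {f g : (ι → ℝ) → ℝ} (hf : IsAffine f) (hg : IsAffine g) :
    IsAffine (fun x => f x - g x) := by
  simpa [sub_eq_add_neg] using hf.add (hg.const_mul (-1))

theorem sum {f : κ → (ι → ℝ) → ℝ} (s : Finset κ) (hf : ∀ k, IsAffine (f k)) :
    IsAffine (fun x => ∑ k ∈ s, f k x) := by
  classical
  induction s using Finset.induction_on with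
  | empty => simpa using const 0
  | insert a s ha ih => simpa [Finset.sum_insert ha] using (hf a).add ih

theorem comp [Fintype κ] [DecidableEq κ] {f : (ι → ℝ) → ℝ} (hf : IsAffine f) (e : ι → κ) :
    IsAffine (fun y : κ → ℝ => f (y ∘ e)) := by
  obtain ⟨c, b, h⟩ := hf
  have hs : IsAffine (fun y : κ → ℝ => ∑ a, c a * y (e a)) :=
    sum _ fun a => (proj (e a)).const_mul (c a)
  simpa [h, dotProduct] using hs.add (const b)

end IsAffine

theorem relu_sub_relu_neg (x : ℝ) : relu x - relu (-x) = x := by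
  unfold relu
  rcases le_total 0 x with h | h <;> simp [h]

/-- `Net D q k R` means that some composition of `k` feed-forward layers of width `D`, each with
at most `2 * D + q` neurons, reads its input in prescribed rows and writes an output related to
it by `R` in prescribed rows. -/
def Net (D q k : ℕ) (R : (ι → ℝ) → (κ → ℝ) → Prop) : Prop :=
  ∀ (e : ι → Fin D) (e' : κ ↪ Fin D), ∃ l : List (FFLayer D), l.length = k ∧
    (∀ F ∈ l, F.r ≤ 2 * D + q) ∧ ∀ y, R (y ∘ e) (runCol l y ∘ e')

namespace Net

variable {D q k k₁ k₂ : ℕ}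

theorem mono {R R' : (ι → ℝ) → (κ → ℝ) → Prop} (h : Net D q k R)
    (hR : ∀ x y, R x y → R' x y) : Net D q k R' := fun e e' => by
  obtain ⟨l, hl, hr, h⟩ := h e e'
  exact ⟨l, hl, hr, fun y => hR _ _ (h y)⟩

theorem comp [Fintype κ] {R₁ : (ι → ℝ) → (κ → ℝ) → Prop} {R₂ : (κ → ℝ) → (μ → ℝ) → Prop}
    (hκ : Fintype.card κ ≤ D) (h₁ : Net D q k₁ R₁) (h₂ : Net D q k₂ R₂) :
    Net D q (k₁ + k₂) (fun x z => ∃ y, R₁ x y ∧ R₂ y z) := fun e e' => by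
  obtain ⟨em⟩ : Nonempty (κ ↪ Fin D) := Function.Embedding.nonempty_of_card_le (by simpa using hκ)
  obtain ⟨l₁, hl₁, hr₁, h₁⟩ := h₁ e em
  obtain ⟨l₂, hl₂, hr₂, h₂⟩ := h₂ em e'
  refine ⟨l₁ ++ l₂, by simp [hl₁, hl₂], fun F hF => ?_, fun y => ⟨runCol l₁ y ∘ em, h₁ y, ?_⟩⟩
  · rcases List.mem_append.1 hF with h | h
    exacts [hr₁ F h, hr₂ F h]
  · simpa [runCol, List.foldl_append] using h₂ (runCol l₁ y)

theorem layer [Fintype ι] [DecidableEq ι] [Fintype P] (hP : Fintype.card P ≤ q)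
    {C : κ → (ι → ℝ) → ℝ} {A : P → (ι → ℝ) → ℝ} (w : κ → P → ℝ)
    (hC : ∀ k, IsAffine (C k)) (hA : ∀ p, IsAffine (A p)) :
    Net D q 1 (fun x y => ∀ k, y k = C k x + ∑ p, w k p * relu (A p x)) := fun e e' => by
  have hC' : ∀ k, IsAffine (fun y : Fin D → ℝ => C k (y ∘ e) - y (e' k)) := fun k =>
    ((hC k).comp e).sub (.proj _)
  have hA' : ∀ p, IsAffine (fun y : Fin D → ℝ => A p (y ∘ e)) := fun p => (hA p).comp e
  choose cC bC hC' using hC'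
  choose cA bA hA' using hA'
  let Q := P ⊕ Fin D ⊕ Fin D
  let q' := Fintype.equivFin Q
  let W1 : Q → Fin D → ℝ := Sum.elim cA (Sum.elim (fun i => Pi.single i 1)
    (fun i => - Pi.single i 1))
  let W2 : κ → Q → ℝ := fun k => Sum.elim (w k) (Sum.elim (cC k) (- cC k))
  let F : FFLayer D :=
    { r := Fintype.card Q
      W1 := Matrix.of fun p => W1 (q'.symm p)
      W2 := Matrix.of fun i p => Function.extend e' W2 0 i (q'.symm p)
      b1 := fun p => Sum.elim bA 0 (q'.symm p)
      b2 := Function.extend e' bC 0 }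
  refine ⟨[F], rfl, ?_, fun y k => ?_⟩
  · intro G hG
    obtain rfl : G = F := by simpa using hG
    simp only [F, Q, Fintype.card_sum, Fintype.card_fin]
    omega
  · have hsum : (F.W2 *ᵥ (fun p => relu ((F.W1 *ᵥ y) p + F.b1 p))) (e' k) =
        ∑ p : Q, W2 k p * relu (W1 p ⬝ᵥ y + Sum.elim bA 0 p) := by
      simp only [F, Matrix.mulVec, dotProduct, Matrix.of_apply, e'.injective.extend_apply]
      exact q'.symm.sum_comp (fun p => W2 k p * relu (W1 p ⬝ᵥ y + Sum.elim bA 0 p))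
    have hlin : ∑ i, (cC k i * relu (y i) + -(cC k i * relu (- y i))) = cC k ⬝ᵥ y := by
      refine Finset.sum_congr rfl fun i _ => ?_
      rw [← sub_eq_add_neg, ← mul_sub, relu_sub_relu_neg]
    have hb : F.b2 (e' k) = bC k := e'.injective.extend_apply _ _ _
    have hk := hC' k y
    simp only [runCol, List.foldl_cons, List.foldl_nil, Function.comp_apply, col, Pi.add_apply,
      hsum, hb]
    simp only [Q, W1, W2, Fintype.sum_sum_type, Sum.elim_inl, Sum.elim_inr, Pi.zero_apply,
      Pi.neg_apply, neg_mul, single_one_dotProduct, neg_dotProduct, add_zero, ← hA',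
      ← Finset.sum_add_distrib, hlin]
    linarith

end Net

/-- The parabola `u ↦ u (1 - u)`. -/
def para (u : ℝ) : ℝ := u * (1 - u)

theorem sum_second_difference (h : ℕ → ℝ) (h0 : h 0 = 0) (v : ℝ) (j : ℕ) :
    ∑ k ∈ Finset.range (j + 1),
      (if k = 0 then h 1 else h (k + 1) - 2 * h k + h (k - 1)) * (v - k) =
      h j + (v - j) * (h (j + 1) - h j) := by
  induction j with
  | zero => simp [h0, mul_comm]
  | succ j ih =>
    rw [Finset.sum_range_succ, ih]
    simp
    ring

/-- A piecewise linear interpolant is a combination of ReLUs. -/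
theorem exists_interpolant {N : ℕ} (hN : 0 < N) (h : ℕ → ℝ) (h0 : h 0 = 0) :
    ∃ c : Fin N → ℝ, ∀ j < N, ∀ t ∈ Set.Icc (0 : ℝ) 1,
      ∑ k, c k * relu ((j + t) / N - (k : ℕ) / N) = h j + t * (h (j + 1) - h j) := by
  have hN' : (0 : ℝ) < N := by exact_mod_cast hN
  refine ⟨fun k => N * if (k : ℕ) = 0 then h 1 else h (k + 1) - 2 * h k + h (k - 1),
    fun j hj t ht => ?_⟩
  have hr : ∀ k : ℕ, relu ((j + t) / N - (k : ℕ) / N) =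
      if k < j + 1 then (j + t - k) / N else 0 := fun k => by
    rw [relu, ← sub_div]
    split_ifs with hk
    · have : (k : ℝ) ≤ j := by exact_mod_cast Nat.lt_succ_iff.1 hk
      exact max_eq_right (div_nonneg (by linarith [ht.1]) hN'.le)
    · have : (j : ℝ) + 1 ≤ k := by exact_mod_cast not_lt.1 hk
      exact max_eq_left (div_nonpos_of_nonpos_of_nonneg (by linarith [ht.2]) hN'.le)
  rw [Fin.sum_univ_eq_sum_range (fun k : ℕ => (N * if k = 0 then h 1 else
    h (k + 1) - 2 * h k + h (k - 1)) * relu ((j + t) / N - (k : ℕ) / N)) N]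
  rw [← Finset.sum_subset (Finset.range_mono (Nat.succ_le_of_lt hj))]
  · have := sum_second_difference h h0 (j + t) j
    rw [add_sub_cancel_left] at this
    rw [← this]
    refine Finset.sum_congr rfl fun k hk => ?_
    rw [hr, if_pos (Finset.mem_range.1 hk)]
    field_simp
  · intro k _ hk
    have hk' : ¬ k < j + 1 := by rwa [Finset.mem_range] at hk
    rw [hr, if_neg hk', mul_zero]

theorem exists_eq_add_div {N : ℕ} (hN : 0 < N) {u : ℝ} (hu : u ∈ Set.Icc (0 : ℝ) 1) :
    ∃ j < N, ∃ t ∈ Set.Icc (0 : ℝ) 1, u = (j + t) / N := by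
  have hN' : (0 : ℝ) < N := by exact_mod_cast hN
  rcases hu.2.eq_or_lt with rfl | h1
  · refine ⟨N - 1, by omega, 1, by simp, ?_⟩
    rw [Nat.cast_sub hN]
    field_simp
    simp
  · have h0 : 0 ≤ u * N := mul_nonneg hu.1 hN'.le
    refine ⟨⌊u * N⌋₊, (Nat.floor_lt h0).2 (by nlinarith), u * N - ⌊u * N⌋₊,
      ⟨sub_nonneg.2 (Nat.floor_le h0), by linarith [Nat.lt_floor_add_one (u * N)]⟩, ?_⟩
    field_simp
    ring

/-- The zigzag map with `N` linear pieces reduces the parabola to its own rescaling by `N⁻²`. -/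
theorem exists_zigzag {N : ℕ} (hN : 0 < N) :
    ∃ a b : Fin N → ℝ, ∀ u ∈ Set.Icc (0 : ℝ) 1,
      (∑ k, a k * relu (u - (k : ℕ) / N)) ∈ Set.Icc (0 : ℝ) 1 ∧
      para u = ∑ k, b k * relu (u - (k : ℕ) / N) +
        ((N : ℝ) ^ 2)⁻¹ * para (∑ k, a k * relu (u - (k : ℕ) / N)) := by
  have hN' : (0 : ℝ) < N := by exact_mod_cast hN
  obtain ⟨a, ha⟩ := exists_interpolant hN (fun k => ((k % 2 : ℕ) : ℝ)) (by simp)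
  obtain ⟨b, hb⟩ := exists_interpolant hN (fun k => para (k / N)) (by simp [para])
  refine ⟨a, b, fun u hu => ?_⟩
  obtain ⟨j, hj, t, ht, rfl⟩ := exists_eq_add_div hN hu
  rw [ha j hj t ht, hb j hj t ht]
  rcases Nat.mod_two_eq_zero_or_one j with h | h
  · have h' : (j + 1) % 2 = 1 := by omega
    rw [h, h']
    refine ⟨by simpa using ht, ?_⟩
    simp only [para]
    push_cast
    field_simp
    ring
  · have h' : (j + 1) % 2 = 0 := by omega
    rw [h, h']
    refine ⟨⟨by push_cast; linarith [ht.2], by push_cast; linarith [ht.1]⟩, ?_⟩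
    simp only [para]
    push_cast
    field_simp
    ring

theorem abs_para_sub_para_le {u v : ℝ} (hu : u ∈ Set.Icc (0 : ℝ) 1)
    (hv : v ∈ Set.Icc (0 : ℝ) 1) : |para u - para v| ≤ 1 / 4 := by
  obtain ⟨hu0, hu1⟩ := hu
  obtain ⟨hv0, hv1⟩ := hv
  simp only [para]
  rw [abs_le]
  constructor <;> nlinarith [sq_nonneg (u - 1 / 2), sq_nonneg (v - 1 / 2),
    mul_nonneg hu0 (sub_nonneg.2 hu1), mul_nonneg hv0 (sub_nonneg.2 hv1)]

/-- Truncation to `[0, 1]`. -/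
def clamp (x : ℝ) : ℝ := relu x - relu (x - 1)

theorem clamp_mem (x : ℝ) : clamp x ∈ Set.Icc (0 : ℝ) 1 := by
  unfold clamp relu
  rcases max_cases 0 x with h | h <;> rcases max_cases 0 (x - 1) with h' | h' <;>
    constructor <;> linarith

theorem abs_clamp_sub_le (x : ℝ) {p : ℝ} (hp : p ∈ Set.Icc (0 : ℝ) 1) :
    |clamp x - p| ≤ |x - p| := by
  obtain ⟨hp0, hp1⟩ := hp
  unfold clamp relu
  rcases max_cases 0 x with h | h <;> rcases max_cases 0 (x - 1) with h' | h' <;>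
  rcases abs_cases (x - p) with h2 | h2 <;> rw [abs_le] <;> constructor <;> linarith

/-- The state of a family, indexed by `I`, of multiplication units with memory `μ`. For each unit
the rows are the current value and two auxiliary rows. -/
abbrev State (μ I : Type) := μ ⊕ (Fin 3 × I)

namespace Net

variable [Fintype μ] [DecidableEq μ] [Fintype I] [DecidableEq I] {D q N : ℕ}

theorem mul_start (g : I → μ) (hq : 4 * Fintype.card I ≤ q) :
    Net D q 1 (fun x y : State μ I → ℝ => (∀ m, y (.inl m) = x (.inl m)) ∧ ∀ i,
      y (.inr (1, i)) ∈ Set.Icc (0 : ℝ) 1 ∧ y (.inr (2, i)) ∈ Set.Icc (0 : ℝ) 1 ∧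
      y (.inr (0, i)) - para (y (.inr (1, i))) + para (y (.inr (2, i))) =
        clamp (x (.inr (0, i))) * clamp (x (.inl (g i)))) := by
  let A : Fin 4 × I → (State μ I → ℝ) → ℝ := fun p x =>
    ![x (.inr (0, p.2)), x (.inr (0, p.2)) - 1, x (.inl (g p.2)), x (.inl (g p.2)) - 1] p.1
  let C : State μ I → (State μ I → ℝ) → ℝ := fun k x =>
    Sum.elim (fun m => x (.inl m)) (fun c => ![-1 / 4, 0, 1 / 2] c.1) k
  let w : State μ I → Fin 4 × I → ℝ := fun k p => Sum.elim 0 (fun c => if c.2 = p.2 then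
    !![1 / 2, -1 / 2, 1 / 2, -1 / 2; 1 / 2, -1 / 2, 1 / 2, -1 / 2;
      1 / 2, -1 / 2, -1 / 2, 1 / 2] c.1 p.1 else 0) k
  have hA : ∀ p, IsAffine (A p) := by
    rintro ⟨p, i⟩
    fin_cases p
    exacts [.proj _, (IsAffine.proj _).sub (.const 1), .proj _, (IsAffine.proj _).sub (.const 1)]
  have hC : ∀ k, IsAffine (C k) := by
    rintro (m | c)
    exacts [.proj _, .const _]
  refine (layer (by simpa using hq) w hC hA).mono fun x y h => ⟨fun m => by simp [h, C, w], ?_⟩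
  intro i
  have hy : ∀ c, y (.inr (c, i)) = ![-1 / 4, 0, 1 / 2] c + ∑ p : Fin 4,
      !![1 / 2, -1 / 2, 1 / 2, -1 / 2; 1 / 2, -1 / 2, 1 / 2, -1 / 2;
        1 / 2, -1 / 2, -1 / 2, 1 / 2] c p * relu (A (p, i) x) := fun c => by
    simp only [h, C, w, Sum.elim_inr, Fintype.sum_prod_type, ite_mul, zero_mul,
      Finset.sum_ite_eq, Finset.mem_univ, if_true]
  have h0 := hy 0
  have h1 := hy 1
  have h2 := hy 2
  simp [Fin.sum_univ_four, A] at h0 h1 h2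
  obtain ⟨hv0, hv1⟩ := clamp_mem (x (.inr (0, i)))
  obtain ⟨hm0, hm1⟩ := clamp_mem (x (.inl (g i)))
  simp only [para]
  unfold clamp at *
  refine ⟨⟨?_, ?_⟩, ⟨?_, ?_⟩, ?_⟩
  · linarith
  · linarith
  · linarith
  · linarith
  · rw [h0, h1, h2]
    ring

theorem mul_step (hN : 0 < N) (hq : 2 * (Fintype.card I * N) ≤ q) (η : ℝ) :
    Net D q 1 (fun x y : State μ I → ℝ => (∀ m, y (.inl m) = x (.inl m)) ∧ ∀ i,
      x (.inr (1, i)) ∈ Set.Icc (0 : ℝ) 1 → x (.inr (2, i)) ∈ Set.Icc (0 : ℝ) 1 →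
      y (.inr (1, i)) ∈ Set.Icc (0 : ℝ) 1 ∧ y (.inr (2, i)) ∈ Set.Icc (0 : ℝ) 1 ∧
      y (.inr (0, i)) - η * ((N : ℝ) ^ 2)⁻¹ * para (y (.inr (1, i))) +
        η * ((N : ℝ) ^ 2)⁻¹ * para (y (.inr (2, i))) =
      x (.inr (0, i)) - η * para (x (.inr (1, i))) + η * para (x (.inr (2, i)))) := by
  obtain ⟨a, b, hab⟩ := exists_zigzag hN
  let A : Fin 2 × I × Fin N → (State μ I → ℝ) → ℝ := fun p x =>
    x (.inr (p.1.succ, p.2.1)) - (p.2.2 : ℕ) / N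
  let C : State μ I → (State μ I → ℝ) → ℝ := fun k x =>
    Sum.elim (fun m => x (.inl m)) (fun c => if c.1 = 0 then x (.inr c) else 0) k
  let v : Fin 3 → Fin 2 → Fin N → ℝ := ![![-η • b, η • b], ![a, 0], ![0, a]]
  let w : State μ I → Fin 2 × I × Fin N → ℝ := fun k p =>
    Sum.elim 0 (fun c => if c.2 = p.2.1 then v c.1 p.1 p.2.2 else 0) k
  have hA : ∀ p, IsAffine (A p) := fun p => (IsAffine.proj _).sub (.const _)
  have hC : ∀ k, IsAffine (C k) := by
    rintro (m | c)
    · exact .proj _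
    · by_cases hc : c.1 = 0
      · simpa [C, hc] using IsAffine.proj _
      · simpa [C, hc] using IsAffine.const _
  refine (layer (by simpa using hq) w hC hA).mono fun x y h => ⟨fun m => by simp [h, C, w], ?_⟩
  intro i hu1 hu2
  have hy : ∀ c, y (.inr (c, i)) = (if c = 0 then x (.inr (c, i)) else 0) +
      (∑ k, v c 0 k * relu (x (.inr (1, i)) - (k : ℕ) / N) +
        ∑ k, v c 1 k * relu (x (.inr (2, i)) - (k : ℕ) / N)) := fun c => by
    simp only [h, C, w, A, Sum.elim_inr, Fintype.sum_prod_type, ite_mul, zero_mul,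
      Finset.sum_ite_irrel, Finset.sum_const_zero,
      Finset.sum_ite_eq, Finset.mem_univ, if_true, Fin.sum_univ_two]
    rfl
  have h0 := hy 0
  have h1 := hy 1
  have h2 := hy 2
  simp [v, mul_assoc, ← Finset.mul_sum] at h0 h1 h2
  obtain ⟨hT1, hp1⟩ := hab _ hu1
  obtain ⟨hT2, hp2⟩ := hab _ hu2
  rw [h0, h1, h2]
  refine ⟨hT1, hT2, ?_⟩
  rw [hp1, hp2]
  ring

theorem mul_steps (hN : 0 < N) (hq : 2 * (Fintype.card I * N) ≤ q)
    (hD : Fintype.card (State μ I) ≤ D) (L : ℕ) (η : ℝ) :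
    Net D q (1 + L) (fun x y : State μ I → ℝ => (∀ m, y (.inl m) = x (.inl m)) ∧ ∀ i,
      x (.inr (1, i)) ∈ Set.Icc (0 : ℝ) 1 → x (.inr (2, i)) ∈ Set.Icc (0 : ℝ) 1 →
      y (.inr (1, i)) ∈ Set.Icc (0 : ℝ) 1 ∧ y (.inr (2, i)) ∈ Set.Icc (0 : ℝ) 1 ∧
      y (.inr (0, i)) - η * (((N : ℝ) ^ 2)⁻¹) ^ (L + 1) * para (y (.inr (1, i))) +
        η * (((N : ℝ) ^ 2)⁻¹) ^ (L + 1) * para (y (.inr (2, i))) =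
      x (.inr (0, i)) - η * para (x (.inr (1, i))) + η * para (x (.inr (2, i)))) := by
  induction L generalizing η with
  | zero => simpa using mul_step hN hq η
  | succ L ih =>
    rw [show 1 + (L + 1) = 1 + L + 1 by ring]
    refine ((ih η).comp hD (mul_step hN hq (η * (((N : ℝ) ^ 2)⁻¹) ^ (L + 1)))).mono ?_
    rintro x z ⟨y, ⟨hm, h⟩, hm', h'⟩
    refine ⟨fun m => (hm' m).trans (hm m), fun i h1 h2 => ?_⟩
    obtain ⟨hy1, hy2, hy⟩ := h i h1 h2
    obtain ⟨hz1, hz2, hz⟩ := h' i hy1 hy2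
    refine ⟨hz1, hz2, ?_⟩
    rw [← hy, ← hz, pow_succ]
    ring

/-- Parallel multiplication of the values of all units by memory entries. -/
theorem mul (hN : 0 < N) (hq : 2 * (Fintype.card I * N) ≤ q) (hq' : 4 * Fintype.card I ≤ q)
    (hD : Fintype.card (State μ I) ≤ D) {L : ℕ} (hL : 0 < L) (g : I → μ) :
    Net D q (L + 1) (fun x y : State μ I → ℝ => (∀ m, y (.inl m) = x (.inl m)) ∧ ∀ i,
      |y (.inr (0, i)) - clamp (x (.inr (0, i))) * clamp (x (.inl (g i)))| ≤
        (((N : ℝ) ^ 2)⁻¹) ^ L / 4) := by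
  obtain ⟨L, rfl⟩ : ∃ L', L = L' + 1 := ⟨L - 1, by omega⟩
  rw [show L + 1 + 1 = 1 + (1 + L) by ring]
  refine ((mul_start g hq').comp hD (mul_steps hN hq hD L 1)).mono ?_
  rintro x z ⟨y, ⟨hm, h⟩, hm', h'⟩
  refine ⟨fun m => (hm' m).trans (hm m), fun i => ?_⟩
  obtain ⟨hy1, hy2, hy⟩ := h i
  obtain ⟨hz1, hz2, hz⟩ := h' i hy1 hy2
  have hp : 0 ≤ (((N : ℝ) ^ 2)⁻¹) ^ (L + 1) := by positivity
  have he : z (.inr (0, i)) - clamp (x (.inr (0, i))) * clamp (x (.inl (g i))) =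
      (((N : ℝ) ^ 2)⁻¹) ^ (L + 1) * (para (z (.inr (1, i))) - para (z (.inr (2, i)))) := by
    linarith
  rw [he, abs_mul, abs_of_nonneg hp]
  have := mul_le_mul_of_nonneg_left (abs_para_sub_para_le hz1 hz2) hp
  linarith

theorem affine {ι κ : Type} [Fintype ι] [DecidableEq ι] {C : κ → (ι → ℝ) → ℝ}
    (hC : ∀ k, IsAffine (C k)) : Net D q 1 (fun x y => ∀ k, y k = C k x) :=
  (layer (P := Empty) (A := fun p => p.elim) (by simp) (fun _ _ => 0) hC fun p => p.elim).mono
    fun x y h k => by simpa using h k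

/-- Parallel computation of products of `T + 1` affine functions, with error propagation. -/
theorem prod {ι : Type} [Fintype ι] [DecidableEq ι] (hN : 0 < N)
    (hq : 2 * (Fintype.card I * N) ≤ q) (hq' : 4 * Fintype.card I ≤ q)
    (hD : Fintype.card (State μ I) ≤ D) {L : ℕ} (hL : 0 < L) {a : μ → (ι → ℝ) → ℝ}
    (ha : ∀ m, IsAffine (a m)) (g : ℕ → I → μ) (T : ℕ) :
    Net D q (1 + T * (L + 1)) (fun x (y : State μ I → ℝ) => (∀ m, y (.inl m) = a m x) ∧
      ∀ (p : μ → ℝ) (η : ℝ), (∀ m, p m ∈ Set.Icc (0 : ℝ) 1) → (∀ m, |a m x - p m| ≤ η) → ∀ i,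
        |y (.inr (0, i)) - ∏ t ∈ Finset.range (T + 1), p (g t i)| ≤
          η + T * (η + (((N : ℝ) ^ 2)⁻¹) ^ L / 4)) := by
  induction T with
  | zero =>
    let C : State μ I → (ι → ℝ) → ℝ := Sum.elim a fun c => a (g 0 c.2)
    have hC : ∀ k, IsAffine (C k) := by
      rintro (m | c)
      exacts [ha m, ha _]
    rw [Nat.zero_mul]
    refine (affine hC).mono fun x y h => ⟨fun m => h _, fun p η _ hx i => ?_⟩
    simpa [h, C] using hx (g 0 i)
  | succ T ih =>
    rw [show 1 + (T + 1) * (L + 1) = 1 + T * (L + 1) + (L + 1) by ring]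
    refine (ih.comp hD (mul hN hq hq' hD hL (g (T + 1)))).mono ?_
    rintro x z ⟨y, ⟨hm, h⟩, hm', h'⟩
    refine ⟨fun m => (hm' m).trans (hm m), fun p η hp hx i => ?_⟩
    have h1 := h p η hp hx i
    have h2 := h' i
    rw [hm] at h2
    rw [Finset.prod_range_succ]
    set P := ∏ t ∈ Finset.range (T + 1), p (g t i)
    have hP : P ∈ Set.Icc (0 : ℝ) 1 := ⟨Finset.prod_nonneg fun t _ => (hp _).1,
      Finset.prod_le_one (fun t _ => (hp _).1) fun t _ => (hp _).2⟩
    set q := p (g (T + 1) i)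
    have hv := (abs_clamp_sub_le (y (.inr (0, i))) hP).trans h1
    have hw := (abs_clamp_sub_le (a (g (T + 1) i) x) (hp _)).trans (hx _)
    set v := clamp (y (.inr (0, i)))
    set w := clamp (a (g (T + 1) i) x)
    have hw01 : w ∈ Set.Icc (0 : ℝ) 1 := clamp_mem _
    have e1 : |(v - P) * w| ≤ |v - P| := by
      rw [abs_mul, abs_of_nonneg hw01.1]
      exact mul_le_of_le_one_right (abs_nonneg _) hw01.2
    have e2 : |P * (w - q)| ≤ |w - q| := by
      rw [abs_mul, abs_of_nonneg hP.1]
      exact mul_le_of_le_one_left (abs_nonneg _) hP.2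
    have e3 : z (.inr (0, i)) - P * q =
        (z (.inr (0, i)) - v * w) + ((v - P) * w + P * (w - q)) := by
      ring
    rw [e3]
    have e4 := abs_add_le (z (.inr (0, i)) - v * w) ((v - P) * w + P * (w - q))
    have e5 := abs_add_le ((v - P) * w) (P * (w - q))
    push_cast
    linarith

end Net

section Codes

variable {d s : ℕ}

/-- Lists of nonempty words of total length at most `s` over an alphabet with `d` letters. -/
abbrev Code (d s : ℕ) := {ws : List (List (Fin d)) // (∀ w ∈ ws, w ≠ []) ∧ ws.flatten.length ≤ s}

/-- Reads a flagged word from the right; a flag marks the first letter of a word. -/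
def decode : List (Fin d × Bool) → List (Fin d) × List (List (Fin d)) :=
  List.foldr (fun c p => if c.2 then ([], (c.1 :: p.1) :: p.2) else (c.1 :: p.1, p.2)) ([], [])

/-- Marks the first letter of each word by a flag. -/
def encode (ws : List (List (Fin d))) : List (Fin d × Bool) :=
  ws.flatMap fun w => w.zipIdx.map fun c => (c.1, decide (c.2 = 0))

theorem length_encode (ws : List (List (Fin d))) : (encode ws).length = ws.flatten.length := by
  simp [encode, List.length_flatMap, List.length_flatten]

theorem decode_append (l l' : List (Fin d × Bool)) (h : ∀ c ∈ l, c.2 = false) :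
    decode (l ++ l') = (l.map Prod.fst ++ (decode l').1, (decode l').2) := by
  induction l with
  | nil => rfl
  | cons c l ih =>
    have := ih fun c hc => h c (List.mem_cons_of_mem _ hc)
    have hc := h c List.mem_cons_self
    simp only [decode, List.cons_append, List.foldr_cons] at this ⊢
    simp [this, hc]

theorem decode_encode (ws : List (List (Fin d))) (h : ∀ w ∈ ws, w ≠ []) :
    decode (encode ws) = ([], ws) := by
  induction ws with
  | nil => rfl
  | cons w ws ih =>
    have ih := ih fun w hw => h w (List.mem_cons_of_mem _ hw)
    obtain ⟨i, r, rfl⟩ := List.exists_cons_of_ne_nil (h w List.mem_cons_self)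
    have he : encode ((i :: r) :: ws) =
        (i, true) :: ((r.zipIdx 1).map (fun c => (c.1, decide (c.2 = 0))) ++ encode ws) := by
      simp [encode, List.zipIdx_cons]
    have hr := decode_append ((r.zipIdx 1).map (fun c => (c.1, decide (c.2 = 0)))) (encode ws) (by
      simp only [List.mem_map]
      rintro _ ⟨⟨a, k⟩, hk, rfl⟩
      have := List.le_snd_of_mem_zipIdx hk
      simp only [decide_eq_false_iff_not] at this ⊢
      omega)
    have hd : ∀ l, decode ((i, true) :: l) = ([], (i :: (decode l).1) :: (decode l).2) :=
      fun l => by simp [decode]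
    rw [he, hd, hr, ih]
    simp [Function.comp_def]

theorem exists_surjective_code (hd : 0 < d) :
    ∃ φ : (Fin s → Fin d × Bool) → Code d s, Function.Surjective φ := by
  classical
  refine ⟨fun c => if h : _ then ⟨(decode (List.ofFn c)).2, h⟩ else ⟨[], by simp⟩, ?_⟩
  rintro ⟨ws, hw, hs⟩
  let l := List.replicate (s - ws.flatten.length) ((⟨0, hd⟩ : Fin d), false) ++ encode ws
  have hl : l.length = s := by
    simp only [l, List.length_append, List.length_replicate, length_encode]
    omega
  have hdec : (decode l).2 = ws := by
    rw [decode_append _ _ (by simp +contextual), decode_encode ws hw]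
  refine ⟨fun t => l.get (t.cast hl.symm), ?_⟩
  have : List.ofFn (fun t : Fin s => l.get (t.cast hl.symm)) = l := by
    apply List.ext_get (by simp [hl])
    intro k h1 h2
    simp
  simp only [this, hdec]
  exact dif_pos ⟨hw, hs⟩

instance [NeZero d] : Finite (Code d s) :=
  let ⟨_, h⟩ := exists_surjective_code (s := s) (Nat.pos_of_neZero d)
  Finite.of_surjective _ h

theorem card_code_le [NeZero d] [Fintype (Code d s)] : Fintype.card (Code d s) ≤ (2 * d) ^ s := by
  obtain ⟨φ, h⟩ := exists_surjective_code (s := s) (Nat.pos_of_neZero d)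
  simpa [mul_comm] using Fintype.card_le_of_surjective φ h

end Codes

section PowerSums

variable {d n s : ℕ}

/-- The value of a word in the entries of the `j`-th column. -/
def wordVal (w : List (Fin d)) (X : Matrix (Fin d) (Fin n) ℝ) (j : Fin n) : ℝ :=
  (w.map fun i => X i j).prod

/-- The average of the values of a word over all columns. -/
noncomputable def wordAvg (w : List (Fin d)) (X : Matrix (Fin d) (Fin n) ℝ) : ℝ :=
  (∑ j, wordVal w X j) / n

/-- The symmetrization of the monomial that has the word `e j` in column `j`. -/
def symSum (e : Fin n → List (Fin d)) (X : Matrix (Fin d) (Fin n) ℝ) : ℝ :=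
  ∑ σ : Equiv.Perm (Fin n), ∏ j, wordVal (e j) X (σ j)

theorem wordVal_append (v w : List (Fin d)) (X : Matrix (Fin d) (Fin n) ℝ) (j : Fin n) :
    wordVal (v ++ w) X j = wordVal v X j * wordVal w X j := by
  simp [wordVal]

theorem symSum_comp (e : Fin n → List (Fin d)) (τ : Equiv.Perm (Fin n))
    (X : Matrix (Fin d) (Fin n) ℝ) : symSum (e ∘ τ) X = symSum e X := by
  rw [symSum, symSum, ← Equiv.sum_comp (Equiv.mulRight τ)]
  refine Finset.sum_congr rfl fun σ _ => ?_
  rw [← Equiv.prod_comp τ (fun j => wordVal (e j) X (σ j))]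
  rfl

theorem symSum_mul_wordAvg (hn : 0 < n) (e : Fin n → List (Fin d)) (w : List (Fin d))
    (X : Matrix (Fin d) (Fin n) ℝ) :
    n * wordAvg w X * symSum e X = ∑ j, symSum (Function.update e j (w ++ e j)) X := by
  have hn' : (n : ℝ) ≠ 0 := by exact_mod_cast hn.ne'
  rw [wordAvg, mul_div_cancel₀ _ hn', symSum, Finset.mul_sum]
  simp only [symSum]
  rw [Finset.sum_comm]
  refine Finset.sum_congr rfl fun σ _ => ?_
  rw [← Equiv.sum_comp σ, Finset.sum_mul]
  refine Finset.sum_congr rfl fun j _ => ?_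
  rw [← Finset.mul_prod_erase _ _ (Finset.mem_univ j),
    ← Finset.mul_prod_erase _ (fun i => wordVal (Function.update e j (w ++ e j) i) X (σ i))
      (Finset.mem_univ j), Function.update_self, wordVal_append, mul_assoc]
  congr 2
  refine Finset.prod_congr rfl fun i hi => ?_
  rw [Function.update_of_ne (Finset.ne_of_mem_erase hi)]

/-- The columns in which a family of words is nontrivial. -/
def wordSupport (e : Fin n → List (Fin d)) : Finset (Fin n) := {j | e j ≠ []}

theorem symSum_update_eq (e : Fin n → List (Fin d)) (w : List (Fin d)) {i j : Fin n}
    (hi : e i = []) (hj : e j = []) (X : Matrix (Fin d) (Fin n) ℝ) :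
    symSum (Function.update e i w) X = symSum (Function.update e j w) X := by
  rw [← symSum_comp (Function.update e j w) (Equiv.swap i j)]
  congr 1
  funext k
  rcases eq_or_ne k i with rfl | hki
  · simp
  · rcases eq_or_ne k j with rfl | hkj
    · rw [Function.update_of_ne hki, Function.comp_apply, Equiv.swap_apply_right,
        Function.update_of_ne hki.symm, hi, hj]
    · rw [Function.update_of_ne hki, Function.comp_apply, Equiv.swap_apply_of_ne_of_ne hki hkj,
        Function.update_of_ne hkj]

/-- The product of the column averages of a list of words. -/
noncomputable def codeVal (ws : List (List (Fin d))) (X : Matrix (Fin d) (Fin n) ℝ) : ℝ :=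
  (ws.map fun w => wordAvg w X).prod

/-- `Hull s C F` means that `F` is a linear combination of products of column averages of words
of total length at most `s`, the absolute values of whose coefficients sum up to at most `C`. -/
def Hull (s : ℕ) [Fintype (Code d s)] (C : ℝ) (F : Matrix (Fin d) (Fin n) ℝ → ℝ) : Prop :=
  ∃ b : Code d s → ℝ, ∑ c, |b c| ≤ C ∧ ∀ X, F X = ∑ c, b c * codeVal c.1 X

namespace Hull

variable [Fintype (Code d s)] {C C' : ℝ} {F G : Matrix (Fin d) (Fin n) ℝ → ℝ}

theorem mono (h : Hull s C F) (hC : C ≤ C') : Hull s C' F :=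
  let ⟨b, hb, hF⟩ := h
  ⟨b, hb.trans hC, hF⟩

theorem const_mul (h : Hull s C F) (r : ℝ) : Hull s (|r| * C) (fun X => r * F X) := by
  obtain ⟨b, hb, hF⟩ := h
  refine ⟨fun c => r * b c, ?_, fun X => by simp [hF, Finset.mul_sum, mul_assoc]⟩
  simp only [abs_mul, ← Finset.mul_sum]
  exact mul_le_mul_of_nonneg_left hb (abs_nonneg r)

theorem add (hF : Hull s C F) (hG : Hull s C' G) : Hull s (C + C') (fun X => F X + G X) := by
  obtain ⟨b, hb, hF⟩ := hF
  obtain ⟨b', hb', hG⟩ := hG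
  refine ⟨fun c => b c + b' c, ?_, fun X => by simp [hF, hG, add_mul, Finset.sum_add_distrib]⟩
  refine (Finset.sum_le_sum fun c _ => abs_add_le (b c) (b' c)).trans ?_
  rw [Finset.sum_add_distrib]
  exact add_le_add hb hb'

theorem sum {κ : Type*} (S : Finset κ) {C : κ → ℝ} {F : κ → Matrix (Fin d) (Fin n) ℝ → ℝ}
    (h : ∀ k ∈ S, Hull s (C k) (F k)) : Hull s (∑ k ∈ S, C k) (fun X => ∑ k ∈ S, F k X) := by
  classical
  induction S using Finset.induction_on with
  | empty => exact ⟨0, by simp, by simp⟩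
  | insert a S ha ih =>
    simp only [Finset.sum_insert ha]
    exact (h a (Finset.mem_insert_self a S)).add
      (ih fun k hk => h k (Finset.mem_insert_of_mem hk))

theorem of_code (c : Code d s) : Hull s 1 (codeVal (n := n) c.1) := by
  classical
  exact ⟨Pi.single c 1, by simp [Pi.single_apply, apply_ite abs], by simp [Pi.single_apply]⟩

end Hull

/-- Newton-type recursion: symmetrized monomials in terms of products of column averages. -/
theorem hull_symSum_mul_codeVal [Fintype (Code d s)] (k : ℕ) (e : Fin n → List (Fin d))
    (he : (wordSupport e).card = k) (ws : List (List (Fin d))) (hw : ∀ w ∈ ws, w ≠ [])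
    (hs : ∑ j, (e j).length + ws.flatten.length ≤ s) :
    Hull s (n.factorial * (n.ascFactorial k / n.descFactorial k))
      (fun X => symSum e X * codeVal ws X) := by
  induction k generalizing e ws with
  | zero =>
    have h0 : ∀ j, e j = [] := fun j => by
      by_contra h
      rw [Finset.card_eq_zero] at he
      exact Finset.notMem_empty j (he ▸ by simp [wordSupport, h])
    have h := (Hull.of_code (n := n) (⟨ws, hw, by omega⟩ : Code d s)).const_mul n.factorial
    simpa [symSum, h0, wordVal, Fintype.card_perm] using h
  | succ k ih =>
    obtain ⟨j₀, hj₀⟩ : (wordSupport e).Nonempty := Finset.card_pos.1 (by omega)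
    have hej : e j₀ ≠ [] := by simpa [wordSupport] using hj₀
    have hn : 0 < n := j₀.pos
    set w := e j₀ with hw₀
    set e' := Function.update e j₀ [] with he'
    have hsupp : wordSupport e' = (wordSupport e).erase j₀ := by
      ext j
      rcases eq_or_ne j j₀ with rfl | h <;> simp [wordSupport, *]
    have hcard : (wordSupport e').card = k := by
      rw [hsupp, Finset.card_erase_of_mem hj₀, he, Nat.add_sub_cancel]
    have hkn : k < n := by
      have := Finset.card_le_univ (wordSupport e)
      rw [he, Fintype.card_fin] at this
      omega
    have hlen : ∑ j, (e' j).length + w.length = ∑ j, (e j).length := by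
      rw [← Finset.add_sum_erase _ _ (Finset.mem_univ j₀),
        ← Finset.add_sum_erase _ (fun j => (e j).length) (Finset.mem_univ j₀), he',
        Function.update_self, ← hw₀, List.length_nil, zero_add, add_comm]
      congr 1
      exact Finset.sum_congr rfl fun j hj => by
        rw [Function.update_of_ne (Finset.ne_of_mem_erase hj)]
    have h1 := ih e' hcard (w :: ws) (by simpa [hej] using hw)
      (by rw [List.flatten_cons, List.length_append]; omega)
    have h2 : ∀ j ∈ wordSupport e', Hull s _
        (fun X => symSum (Function.update e' j (w ++ e' j)) X * codeVal ws X) := fun j hj => by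
      refine ih _ ?_ ws hw ?_
      · rw [← hcard]
        congr 1
        ext i
        have : e' j ≠ [] := by simpa [wordSupport] using hj
        simp only [wordSupport, Finset.mem_filter_univ]
        rcases eq_or_ne i j with rfl | h
        · simp [Function.update_self, this]
        · rw [Function.update_of_ne h]
      · have : ∑ i, (Function.update e' j (w ++ e' j) i).length =
            ∑ i, (e' i).length + w.length := by
          rw [← Finset.add_sum_erase _ _ (Finset.mem_univ j),
            ← Finset.add_sum_erase _ (fun i => (e' i).length) (Finset.mem_univ j),
            Function.update_self, List.length_append, Finset.sum_congr rfl fun i hi => by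
              rw [Function.update_of_ne (Finset.ne_of_mem_erase hi)]]
          omega
        omega
    have hnk : (0 : ℝ) < n - k := by
      rw [sub_pos]
      exact_mod_cast hkn
    have h3 := ((h1.const_mul n).add ((Hull.sum _ h2).const_mul (-1))).const_mul ((n - k : ℝ)⁻¹)
    have hfun : (fun X => symSum e X * codeVal ws X) = fun X => (n - k : ℝ)⁻¹ *
        (n * (symSum e' X * codeVal (w :: ws) X) + -1 * ∑ j ∈ wordSupport e',
          symSum (Function.update e' j (w ++ e' j)) X * codeVal ws X) := by
      funext X
      have hN := symSum_mul_wordAvg hn e' w X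
      have hc : ∑ j ∈ (wordSupport e')ᶜ, symSum (Function.update e' j (w ++ e' j)) X =
          (n - k) * symSum e X := by
        rw [Finset.sum_congr rfl (g := fun _ => symSum e X), Finset.sum_const,
          Finset.card_compl, hcard, Fintype.card_fin, nsmul_eq_mul, Nat.cast_sub hkn.le]
        intro j hj
        have hj' : e' j = [] := by simpa [wordSupport] using hj
        rw [hj', List.append_nil, symSum_update_eq e' w hj' (j := j₀) (by simp [he']), he',
          Function.update_idem, hw₀, Function.update_eq_self]
      rw [← Finset.sum_add_sum_compl (wordSupport e'), hc] at hN
      rw [← Finset.sum_mul, eq_inv_mul_iff_mul_eq₀ hnk.ne', codeVal, codeVal, List.map_cons,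
        List.prod_cons]
      linear_combination (-(List.map (fun w => wordAvg w X) ws).prod) * hN
    rw [hfun]
    refine h3.mono (le_of_eq ?_)
    rw [Finset.sum_const, hcard, nsmul_eq_mul, Nat.ascFactorial_succ, Nat.descFactorial_succ,
      abs_of_pos (inv_pos.2 hnk), Nat.abs_cast, abs_neg, abs_one]
    have hd : (n.descFactorial k : ℝ) ≠ 0 := by
      exact_mod_cast (Nat.descFactorial_pos.2 hkn.le).ne'
    push_cast [Nat.cast_sub hkn.le]
    field_simp

theorem ascFactorial_le (n k : ℕ) (h : k ≤ n) :
    n.ascFactorial k ≤ 4 ^ k * n.descFactorial k := by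
  induction k generalizing n with
  | zero => simp
  | succ k ih =>
    obtain ⟨n, rfl⟩ : ∃ m, n = m + 1 := ⟨n - 1, by omega⟩
    have ih := ih n (by omega)
    rw [Nat.succ_descFactorial_succ, Nat.ascFactorial_succ]
    rcases Nat.eq_zero_or_pos n with rfl | hn
    · obtain rfl : k = 0 := by omega
      simp
    · have h1 : n * (n + 1).ascFactorial k = (n + k) * n.ascFactorial k := by
        rw [Nat.succ_ascFactorial]
      refine Nat.le_of_mul_le_mul_left ?_ hn
      calc n * ((n + 1 + k) * (n + 1).ascFactorial k)
          = (n + 1 + k) * (n + k) * n.ascFactorial k := by rw [mul_left_comm, h1, mul_assoc]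
        _ ≤ (4 * (n * (n + 1))) * (4 ^ k * n.descFactorial k) :=
          Nat.mul_le_mul (by nlinarith) ih
        _ = n * (4 ^ (k + 1) * ((n + 1) * n.descFactorial k)) := by ring

end PowerSums

section Symmetric

variable {d n s : ℕ}

/-- The word with `m (i, j)` copies of each letter `i`. -/
def columnWord (m : Fin d × Fin n →₀ ℕ) (j : Fin n) : List (Fin d) :=
  (List.ofFn fun i => List.replicate (m (i, j)) i).flatten

theorem wordVal_columnWord (m : Fin d × Fin n →₀ ℕ) (X : Matrix (Fin d) (Fin n) ℝ)
    (j k : Fin n) : wordVal (columnWord m j) X k = ∏ i, X i k ^ m (i, j) := by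
  simp [wordVal, columnWord, List.map_flatten, List.prod_flatten, List.map_ofFn, List.prod_ofFn]

theorem length_columnWord (m : Fin d × Fin n →₀ ℕ) (j : Fin n) :
    (columnWord m j).length = ∑ i, m (i, j) := by
  simp [columnWord, List.length_flatten, List.map_ofFn, List.sum_ofFn]

theorem factorial_mul_eval {f : MvPolynomial (Fin d × Fin n) ℝ} (hf : ColSym f)
    (X : Matrix (Fin d) (Fin n) ℝ) :
    n.factorial * MvPolynomial.eval (fun v => X v.1 v.2) f =
      ∑ m ∈ f.support, f.coeff m * symSum (columnWord m) X := by
  have h : ∀ σ : Equiv.Perm (Fin n), MvPolynomial.eval (fun v => X v.1 v.2) f =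
      ∑ m ∈ f.support, f.coeff m * ∏ j, wordVal (columnWord m j) X (σ j) := fun σ => by
    conv_lhs => rw [← hf σ, MvPolynomial.eval_rename, MvPolynomial.eval_eq']
    refine Finset.sum_congr rfl fun m _ => ?_
    rw [Fintype.prod_prod_type, Finset.prod_comm]
    simp [wordVal_columnWord]
  have h' := Finset.sum_congr (rfl : (Finset.univ : Finset (Equiv.Perm (Fin n))) = _)
    fun σ _ => h σ
  rw [Finset.sum_const, Finset.card_univ, Fintype.card_perm, Fintype.card_fin, nsmul_eq_mul,
    Finset.sum_comm] at h'
  rw [h']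
  simp only [symSum, Finset.mul_sum]

theorem hull_symSum [Fintype (Code d s)] (e : Fin n → List (Fin d))
    (he : ∑ j, (e j).length ≤ s) : Hull s (n.factorial * 4 ^ s) (symSum e) := by
  have h := hull_symSum_mul_codeVal _ e rfl [] (by simp) (by simpa using he)
  have hk : (wordSupport e).card ≤ n := by simpa using Finset.card_le_univ (wordSupport e)
  have hks : (wordSupport e).card ≤ s := by
    refine le_trans ?_ he
    rw [Finset.card_eq_sum_ones]
    refine le_trans (Finset.sum_le_sum fun j hj => ?_)
      (Finset.sum_le_univ_sum_of_nonneg fun j => Nat.zero_le (e j).length)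
    exact List.length_pos_iff.2 (by simpa [wordSupport] using hj)
  simp only [codeVal, List.map_nil, List.prod_nil, mul_one] at h
  refine h.mono (mul_le_mul_of_nonneg_left ?_ (Nat.cast_nonneg _))
  rw [div_le_iff₀ (by exact_mod_cast Nat.descFactorial_pos.2 hk)]
  exact_mod_cast (ascFactorial_le n _ hk).trans
    (Nat.mul_le_mul_right _ (Nat.pow_le_pow_right (by norm_num) hks))

theorem hull_eval [Fintype (Code d s)] {f : MvPolynomial (Fin d × Fin n) ℝ} (hf : ColSym f)
    (hdeg : f.totalDegree ≤ s) (hpos : ∀ m ∈ f.support, 0 ≤ f.coeff m)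
    (hone : MvPolynomial.eval (fun _ => 1) f ≤ 1) :
    Hull s (4 ^ s) (fun X => MvPolynomial.eval (fun v => X v.1 v.2) f) := by
  have hfac : (0 : ℝ) < n.factorial := by exact_mod_cast n.factorial_pos
  have h : ∀ m ∈ f.support, Hull s (n.factorial * 4 ^ s) (symSum (columnWord m)) :=
    fun m hm => hull_symSum _ <| by
      have := MvPolynomial.le_totalDegree hm
      rw [Finsupp.sum_fintype _ _ (fun _ => rfl), Fintype.sum_prod_type, Finset.sum_comm] at this
      simpa only [length_columnWord] using this.trans hdeg
  have h' := (Hull.sum _ fun m hm => (h m hm).const_mul (f.coeff m)).const_mul (n.factorial : ℝ)⁻¹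
  have hfun : (fun X : Matrix (Fin d) (Fin n) ℝ => MvPolynomial.eval (fun v => X v.1 v.2) f) =
      fun X => (n.factorial : ℝ)⁻¹ * ∑ m ∈ f.support, f.coeff m * symSum (columnWord m) X := by
    funext X
    rw [← factorial_mul_eval hf, inv_mul_cancel_left₀ hfac.ne']
  rw [hfun]
  refine h'.mono ?_
  rw [MvPolynomial.eval_eq'] at hone
  simp only [one_pow, Finset.prod_const_one, mul_one] at hone
  rw [← Finset.sum_mul, Finset.sum_congr rfl fun m hm => abs_of_nonneg (hpos m hm),
    abs_of_pos (inv_pos.2 hfac), mul_left_comm, inv_mul_cancel_left₀ hfac.ne']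
  exact mul_le_of_le_one_left (by positivity) hone

end Symmetric

section Letters

variable {d n s : ℕ}

theorem prod_range_getElem? {α : Type*} (w : List α) (F : α → ℝ) (hw : w.length ≤ s) :
    ∏ t ∈ Finset.range s, (w[t]?).elim 1 F = (w.map F).prod := by
  induction w generalizing s with
  | nil => simp
  | cons a w ih =>
    obtain ⟨s, rfl⟩ : ∃ r, s = r + 1 := ⟨s - 1, by simp at hw; omega⟩
    rw [Finset.prod_range_succ', List.map_cons, List.prod_cons, ← ih (by simpa using hw), mul_comm]
    simp

/-- The `t`-th letter of a padded word, or `none` past its end. -/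
def letter (t : ℕ) (w : Fin s → Option (Fin d)) : Option (Fin d) :=
  if h : t < s then w ⟨t, h⟩ else none

/-- The word `w` padded to length `s`. -/
def pad (s : ℕ) (w : List (Fin d)) : Fin s → Option (Fin d) := fun t => w[(t : ℕ)]?

theorem prod_letter_pad (w : List (Fin d)) (hw : w.length ≤ s) (X : Matrix (Fin d) (Fin n) ℝ)
    (j : Fin n) :
    ∏ t ∈ Finset.range s, (letter t (pad s w)).elim 1 (fun i => X i j) = wordVal w X j := by
  rw [wordVal, ← prod_range_getElem? w _ hw]
  refine Finset.prod_congr rfl fun t ht => ?_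
  rw [letter, dif_pos (Finset.mem_range.1 ht), pad]

/-- The average over all columns of the value of a padded word. -/
noncomputable def padAvg (X : Matrix (Fin d) (Fin n) ℝ) (w : Fin s → Option (Fin d)) : ℝ :=
  (∑ j, ∏ t ∈ Finset.range s, (letter t w).elim 1 (fun i => X i j)) / n

theorem padAvg_pad (w : List (Fin d)) (hw : w.length ≤ s) (X : Matrix (Fin d) (Fin n) ℝ) :
    padAvg X (pad s w) = wordAvg w X := by
  simp only [padAvg, prod_letter_pad w hw, wordAvg]

theorem prod_padAvg (hn : 0 < n) (c : Code d s) (X : Matrix (Fin d) (Fin n) ℝ) :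
    ∏ t ∈ Finset.range s, padAvg X (pad s (c.1[t]?.getD [])) = codeVal c.1 X := by
  obtain ⟨ws, hw, hs⟩ := c
  have hlen : ws.length ≤ s := by
    refine le_trans ?_ hs
    rw [List.length_flatten, ← mul_one ws.length, ← smul_eq_mul, ← List.length_map (as := ws)]
    refine List.card_nsmul_le_sum _ _ fun k hk => ?_
    obtain ⟨w, hmem, rfl⟩ := List.mem_map.1 hk
    exact List.length_pos_iff.2 (hw w hmem)
  rw [codeVal, ← prod_range_getElem? ws _ hlen]
  refine Finset.prod_congr rfl fun t _ => ?_
  rcases h : ws[t]? with _ | w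
  · have hn' : (n : ℝ) ≠ 0 := by exact_mod_cast hn.ne'
    simp [padAvg_pad, wordAvg, wordVal, hn']
  · have : w.length ≤ s :=
      (List.sublist_flatten_of_mem (List.mem_of_getElem? h)).length_le.trans hs
    simp [padAvg_pad w this]

theorem elim_mem_Icc {x : Fin d → ℝ} (hx : ∀ i, x i ∈ Set.Icc (0 : ℝ) 1) (o : Option (Fin d)) :
    o.elim 1 x ∈ Set.Icc (0 : ℝ) 1 := by
  cases o with
  | none => simp
  | some i => exact hx i

theorem padAvg_mem_Icc {X : Matrix (Fin d) (Fin n) ℝ} (hX : ∀ i j, X i j ∈ Set.Icc (0 : ℝ) 1)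
    (w : Fin s → Option (Fin d)) : padAvg X w ∈ Set.Icc (0 : ℝ) 1 := by
  have h : ∀ j t, (letter t w).elim 1 (fun i => X i j) ∈ Set.Icc (0 : ℝ) 1 :=
    fun j t => elim_mem_Icc (fun i => hX i j) _
  refine ⟨div_nonneg (Finset.sum_nonneg fun j _ => Finset.prod_nonneg fun t _ => (h j t).1)
    (Nat.cast_nonneg n), div_le_one_of_le₀ ?_ (Nat.cast_nonneg n)⟩
  simpa using Finset.sum_le_card_nsmul Finset.univ _ 1 fun j _ =>
    Finset.prod_le_one (fun t _ => (h j t).1) fun t _ => (h j t).2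

end Letters

section Blocks

variable {D n : ℕ}

/-- A single-head attention layer with uniform attention. -/
def uniformAttn (m : ℕ) (WO : Matrix (Fin D) (Fin m) ℝ) (WV : Matrix (Fin m) (Fin D) ℝ) :
    AttnLayer D :=
  ⟨m, 1, fun _ => WO, fun _ => WV, fun _ => 0, fun _ => 0⟩

theorem uniformAttn_apply (m : ℕ) (WO : Matrix (Fin D) (Fin m) ℝ)
    (WV : Matrix (Fin m) (Fin D) ℝ) (X : Matrix (Fin D) (Fin n) ℝ) :
    (uniformAttn m WO WV).apply X =
      X + WO * (WV * X * (Matrix.of fun _ _ => (n : ℝ)⁻¹ : Matrix (Fin n) (Fin n) ℝ)) := by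
  have h : softmax (((0 : Matrix (Fin m) (Fin D) ℝ) * X)ᵀ * ((0 : Matrix (Fin m) (Fin D) ℝ) * X)) =
      Matrix.of fun _ _ => (n : ℝ)⁻¹ := by
    ext i j
    simp [softmax]
  rw [← h]
  exact congrArg (X + ·) (Fin.sum_univ_one _)

/-- A block whose single-head attention layer acts as the identity. -/
def plainBlock (F : FFLayer D) : TransformerBlock D := ⟨uniformAttn 0 0 0, F⟩

/-- A block whose single-head attention layer adds the average of all columns to each column. -/
def avgBlock (F : FFLayer D) : TransformerBlock D := ⟨uniformAttn D 1 1, F⟩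

theorem plainBlock_apply (F : FFLayer D) (X : Matrix (Fin D) (Fin n) ℝ) :
    (plainBlock F).apply X = F.apply X := by
  simp [plainBlock, TransformerBlock.apply, uniformAttn_apply]

theorem avgBlock_apply (F : FFLayer D) (X : Matrix (Fin D) (Fin n) ℝ) (j : Fin n) :
    (fun i => (avgBlock F).apply X i j) = col F (fun i => X i j + (∑ l, X i l) / n) := by
  rw [TransformerBlock.apply, apply_col]
  congr 1
  funext i
  simp [avgBlock, uniformAttn_apply, Matrix.mul_apply, Finset.sum_mul, div_eq_mul_inv]

theorem applyNet_map_plainBlock (l : List (FFLayer D)) (X : Matrix (Fin D) (Fin n) ℝ)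
    (j : Fin n) :
    (fun i => applyNet (l.map plainBlock) X i j) = runCol l (fun i => X i j) := by
  induction l generalizing X with
  | nil => rfl
  | cons F l ih =>
    have := ih (F.apply X)
    rw [apply_col] at this
    simpa [applyNet, runCol, plainBlock_apply] using this

theorem applyNet_avgBlock (l l' : List (FFLayer D)) (F : FFLayer D)
    (X : Matrix (Fin D) (Fin n) ℝ) (j : Fin n) :
    (fun i => applyNet (l.map plainBlock ++ avgBlock F :: l'.map plainBlock) X i j) =
      runCol (F :: l') (fun i => runCol l (fun i => X i j) i +
        (∑ k, runCol l (fun i => X i k) i) / n) := by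
  have h : applyNet (l.map plainBlock ++ avgBlock F :: l'.map plainBlock) X =
      applyNet (l'.map plainBlock) ((avgBlock F).apply (applyNet (l.map plainBlock) X)) := by
    simp [applyNet, List.foldl_append]
  have h' : ∀ i k, applyNet (l.map plainBlock) X i k = runCol l (fun i => X i k) i :=
    fun i k => congrFun (applyNet_map_plainBlock l X k) i
  rw [h, applyNet_map_plainBlock, avgBlock_apply]
  simp only [h', runCol, List.foldl_cons]

end Blocks

theorem embed_castSucc {d n D : ℕ} (hd : d ≤ D) (X : Matrix (Fin d) (Fin n) ℝ) (j : Fin n) :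
    (fun i => embed D (n + 1) X i j.castSucc) ∘ Fin.castLE hd = fun i => X i j := by
  funext i
  simp [embed]

theorem embed_last {d n D : ℕ} (X : Matrix (Fin d) (Fin n) ℝ) :
    (fun i => embed D (n + 1) X i (Fin.last n)) = 0 := by
  funext i
  simp [embed]

section Approximation

variable {d n s N L D q : ℕ}

/-- Parallel computation of the values of all padded words. -/
theorem net_letters (hN : 0 < N) (hL : 0 < L)
    (hq : 2 * ((d + 1) ^ (s + 1) * N) ≤ q) (hq' : 4 * (d + 1) ^ (s + 1) ≤ q)
    (hD : d + 1 + 3 * (d + 1) ^ (s + 1) ≤ D) :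
    Net D q (1 + s * (L + 1) + 1)
      (fun (x : Fin d → ℝ) (y : (Fin (s + 1) → Option (Fin d)) → ℝ) =>
        (∀ i, x i ∈ Set.Icc (0 : ℝ) 1) → ∀ w,
          |y w - ∏ t ∈ Finset.range (s + 1), (letter t w).elim 1 x| ≤
            s * ((((N : ℝ) ^ 2)⁻¹) ^ L / 4)) := by
  have hcard : Fintype.card (Fin (s + 1) → Option (Fin d)) = (d + 1) ^ (s + 1) := by simp
  have hcard' : Fintype.card (State (Option (Fin d)) (Fin (s + 1) → Option (Fin d))) ≤ D := by
    simpa [State] using hD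
  refine ((Net.prod hN (hcard ▸ hq) (hcard ▸ hq') hcard' hL
    (a := fun o x => o.elim 1 x) (fun o => ?_) letter s).comp hcard'
    (Net.affine fun w => .proj (.inr (0, w)))).mono ?_
  · cases o with
    | none => exact .const 1
    | some i => exact .proj i
  · rintro x z ⟨y, ⟨-, hy⟩, hz⟩ hx w
    simpa [hz] using hy (fun o => o.elim 1 x) 0 (elim_mem_Icc hx) (by simp) w

/-- Computation of a linear combination of products of padded words. -/
theorem net_codes [Fintype (Code d (s + 1))] (hN : 0 < N) (hL : 0 < L)
    (hq : 2 * (Fintype.card (Code d (s + 1)) * N) ≤ q)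
    (hq' : 4 * Fintype.card (Code d (s + 1)) ≤ q)
    (hD : (d + 1) ^ (s + 1) + 3 * Fintype.card (Code d (s + 1)) ≤ D)
    {ι : Type} [Fintype ι] [DecidableEq ι]
    {a : (Fin (s + 1) → Option (Fin d)) → (ι → ℝ) → ℝ} (ha : ∀ w, IsAffine (a w))
    (b : Code d (s + 1) → ℝ) :
    Net D q (1 + s * (L + 1) + 1) (fun x (y : Unit → ℝ) =>
      ∀ (p : (Fin (s + 1) → Option (Fin d)) → ℝ) (η : ℝ),
      (∀ w, p w ∈ Set.Icc (0 : ℝ) 1) → (∀ w, |a w x - p w| ≤ η) →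
        |∑ c, b c * ∏ t ∈ Finset.range (s + 1), p (pad (s + 1) (c.1[t]?.getD [])) - y ()| ≤
          (∑ c, |b c|) * (η + s * (η + (((N : ℝ) ^ 2)⁻¹) ^ L / 4))) := by
  classical
  have hcard : Fintype.card (State (Fin (s + 1) → Option (Fin d)) (Code d (s + 1))) ≤ D := by
    simpa [State] using hD
  refine ((Net.prod hN hq hq' hcard hL ha (fun t c => pad (s + 1) (c.1[t]?.getD [])) s).comp hcard
    (Net.affine (κ := Unit) (C := fun _ y => ∑ c, b c * y (.inr (0, c)))
      fun _ => .sum _ fun c => (IsAffine.proj _).const_mul (b c))).mono ?_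
  rintro x z ⟨y, ⟨-, hy⟩, hz⟩ p η hp hx
  rw [hz, ← Finset.sum_sub_distrib, Finset.sum_mul]
  refine (Finset.abs_sum_le_sum_abs _ _).trans (Finset.sum_le_sum fun c _ => ?_)
  rw [← mul_sub, abs_mul, abs_sub_comm]
  exact mul_le_mul_of_nonneg_left (hy p η hp hx c) (abs_nonneg _)

/-- A linear combination of products of column averages of words is approximated by a network. -/
theorem exists_net [Fintype (Code d (s + 1))] (hn : 0 < n) (hN : 0 < N) (hL : 0 < L)
    (hq : 2 * ((2 * d) ^ (s + 1) * N) ≤ q) (hq' : 4 * (2 * d) ^ (s + 1) ≤ q)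
    (hD : 4 * (2 * d) ^ (s + 1) ≤ D) (hd : 0 < d)
    {C : ℝ} {F : Matrix (Fin d) (Fin n) ℝ → ℝ} (hF : Hull (s + 1) C F) :
    ∃ (net : List (TransformerBlock D)) (i0 : Fin D),
      (∀ B ∈ net, B.attn.m ≤ D ∧ B.ff.r ≤ 2 * D + q ∧ B.attn.h = 1) ∧
      net.length = 2 * (s * (L + 1)) + 4 ∧
      ∀ X : Matrix (Fin d) (Fin n) ℝ, (∀ i j, X i j ∈ Set.Icc (0 : ℝ) 1) →
        |F X - applyNet net (embed D (n + 1) X) i0 (Fin.last n)| ≤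
          C * (s * (s + 2) * ((((N : ℝ) ^ 2)⁻¹) ^ L / 4)) := by
  obtain ⟨b, hb, hF⟩ := hF
  set M := (2 * d) ^ (s + 1) with hM
  have : NeZero d := ⟨hd.ne'⟩
  have hW : (d + 1) ^ (s + 1) ≤ M := Nat.pow_le_pow_left (by omega) _
  have hcode : Fintype.card (Code d (s + 1)) ≤ M := card_code_le
  have hdM : 2 * d ≤ M := Nat.le_self_pow (by omega) _
  have hWN := Nat.mul_le_mul_right N hW
  have hcN := Nat.mul_le_mul_right N hcode
  have hn' : (0 : ℝ) < n := by exact_mod_cast hn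
  obtain ⟨ρ⟩ : Nonempty ((Fin (s + 1) → Option (Fin d)) ↪ Fin D) :=
    Function.Embedding.nonempty_of_card_le (by simp; omega)
  have hdD : d ≤ D := by omega
  obtain ⟨l₁, hl₁, hr₁, h₁⟩ := net_letters (s := s) (D := D) (q := q) hN hL (by omega) (by omega)
    (by omega) (Fin.castLE hdD) ρ
  let c : (Fin (s + 1) → Option (Fin d)) → ℝ := fun w => runCol l₁ 0 (ρ w)
  let a : (Fin (s + 1) → Option (Fin d)) → ((Fin (s + 1) → Option (Fin d)) → ℝ) → ℝ :=
    fun w z => ((n + 1 : ℝ) / n) * (z w - (c w + c w / (n + 1)))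
  have ha : ∀ w, IsAffine (a w) := fun w => ((IsAffine.proj w).sub (.const _)).const_mul _
  have i0 : Fin D := ⟨0, by omega⟩
  obtain ⟨l₂, hl₂, hr₂, h₂⟩ := net_codes (D := D) (q := q) hN hL (by omega) (by omega)
    (by omega) ha b ρ ⟨fun _ => i0, fun _ _ _ => rfl⟩
  obtain ⟨G, l₂, rfl⟩ := List.exists_cons_of_length_pos (by omega : 0 < l₂.length)
  refine ⟨l₁.map plainBlock ++ avgBlock G :: l₂.map plainBlock, i0, ?_, ?_, fun X hX => ?_⟩
  · intro B hB
    rcases List.mem_append.1 hB with h | h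
    · obtain ⟨H, hH, rfl⟩ := List.mem_map.1 h
      exact ⟨Nat.zero_le _, hr₁ H hH, rfl⟩
    · rcases List.mem_cons.1 h with rfl | h
      · exact ⟨le_rfl, hr₂ G List.mem_cons_self, rfl⟩
      · obtain ⟨H, hH, rfl⟩ := List.mem_map.1 h
        exact ⟨Nat.zero_le _, hr₂ H (List.mem_cons_of_mem _ hH), rfl⟩
  · simp only [List.length_cons] at hl₂
    simp only [List.length_append, List.length_cons, List.length_map]
    omega
  · set δ : ℝ := (((N : ℝ) ^ 2)⁻¹) ^ L / 4 with hδ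
    let Y : Fin n → Fin D → ℝ := fun j => runCol l₁ fun i => embed D (n + 1) X i j.castSucc
    have hY : ∀ j w, |Y j (ρ w) - ∏ t ∈ Finset.range (s + 1),
        (letter t w).elim 1 (fun i => X i j)| ≤ s * δ := fun j w => by
      have := h₁ (fun i => embed D (n + 1) X i j.castSucc)
      rw [embed_castSucc] at this
      exact this (fun i => hX i j) w
    rw [congrFun (applyNet_avgBlock l₁ l₂ G _ _) i0]
    set z : Fin D → ℝ := fun i =>
      runCol l₁ (fun i => embed D (n + 1) X i (Fin.last n)) i +
        (∑ k, runCol l₁ (fun i => embed D (n + 1) X i k) i) / ((n + 1 : ℕ) : ℝ) with hz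
    have hza : ∀ w, a w (z ∘ ρ) = (∑ j, Y j (ρ w)) / n := fun w => by
      simp only [a, c, Function.comp_apply, hz, Fin.sum_univ_castSucc, embed_last, Y]
      push_cast
      field_simp
      ring
    have hη : ∀ w, |a w (z ∘ ρ) - padAvg X w| ≤ s * δ := fun w => by
      rw [hza, padAvg, ← sub_div, ← Finset.sum_sub_distrib, abs_div, Nat.abs_cast,
        div_le_iff₀ hn']
      refine (Finset.abs_sum_le_sum_abs _ _).trans
        ((Finset.sum_le_sum fun j _ => hY j w).trans (le_of_eq ?_))
      simp [mul_comm]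
    have h := h₂ z (padAvg X) (s * δ) (padAvg_mem_Icc hX) hη
    simp only [prod_padAvg hn, ← hF] at h
    refine h.trans (le_trans (le_of_eq ?_) (mul_le_mul_of_nonneg_right hb ?_))
    · ring
    · positivity

end Approximation

theorem sq_add_two_mul_lt (s : ℕ) : s * (s + 2) < 4 * 2 ^ (s + 1) := by
  induction s with
  | zero => norm_num
  | succ s ih =>
    rw [pow_succ]
    have := Nat.lt_two_pow_self (n := s + 1)
    nlinarith

end SymTransformer

/-- Universal approximation of column-symmetric polynomials by single-head
Transformer networks: for any degree-`s` column-symmetric polynomial `f` on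
`[0,1]^{d×n}` with positive coefficients and sup-norm at most `1`, and any
`N, L ≥ 1`, there is a Transformer network of width at most `12·(2d)^s·N`,
depth at most `2sL + 3s`, all of whose attention layers have a single head,
which approximates `f` at a designated output entry (independent of `X`) with
uniform error less than `8^s · N^{−L}`. -/
theorem stmt0 (d n s : ℕ) (hd : 0 < d) (hn : 0 < n) (hs : 0 < s)
    (f : MvPolynomial (Fin d × Fin n) ℝ)
    (hsym : ColSym f)
    (hdeg : f.totalDegree = s)
    (hpos : ∀ m ∈ f.support, 0 < f.coeff m)
    (hbound : ∀ X : Matrix (Fin d) (Fin n) ℝ, (∀ i j, X i j ∈ Set.Icc (0:ℝ) 1) →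
      |MvPolynomial.eval (fun v => X v.1 v.2) f| ≤ 1)
    (N L : ℕ) (hN : 0 < N) (hL : 0 < L) :
    ∃ (d' : ℕ) (net : List (TransformerBlock d')) (i0 : Fin d') (j0 : Fin (n+1)),
      d' ≤ 12 * (2*d)^s * N ∧
      (∀ B ∈ net, B.attn.m ≤ 12 * (2*d)^s * N ∧ B.ff.r ≤ 12 * (2*d)^s * N) ∧
      net.length ≤ 2*s*L + 3*s ∧
      (∀ B ∈ net, B.attn.h = 1) ∧
      ∀ X : Matrix (Fin d) (Fin n) ℝ, (∀ i j, X i j ∈ Set.Icc (0:ℝ) 1) →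
        |MvPolynomial.eval (fun v => X v.1 v.2) f -
            applyNet net (embed d' (n+1) X) i0 j0| < 8^s / (N : ℝ)^L := by
  obtain ⟨s, rfl⟩ : ∃ r, s = r + 1 := ⟨s - 1, by omega⟩
  have : NeZero d := ⟨hd.ne'⟩
  let := Fintype.ofFinite (SymTransformer.Code d (s + 1))
  have hone : MvPolynomial.eval (fun _ => 1) f ≤ 1 :=
    (le_abs_self _).trans (hbound (fun _ _ => 1) fun _ _ => ⟨zero_le_one, le_rfl⟩)
  have hF := SymTransformer.hull_eval hsym hdeg.le (fun m hm => (hpos m hm).le) hone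
  set M := (2 * d) ^ (s + 1) with hM
  have hMN : M ≤ M * N := Nat.le_mul_of_pos_right M hN
  obtain ⟨net, i0, hB, hlen, h⟩ := SymTransformer.exists_net (D := 4 * M) (q := 4 * (M * N))
    hn hN hL (by rw [← hM]; omega) (by rw [← hM]; omega) le_rfl hd hF
  have hassoc : 12 * M * N = 12 * (M * N) := by ring
  refine ⟨4 * M, net, i0, Fin.last n, by omega, fun B hmem => ?_, ?_, fun B hmem => (hB B hmem).2.2,
    fun X hX => (h X hX).trans_lt ?_⟩
  · have := hB B hmem
    omega
  · rw [hlen]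
    nlinarith
  · have hN1 : (1 : ℝ) ≤ (N : ℝ) ^ L := one_le_pow₀ (by exact_mod_cast hN)
    have hs' : (s : ℝ) * (s + 2) < 4 * 2 ^ (s + 1) := by
      exact_mod_cast SymTransformer.sq_add_two_mul_lt s
    set ε : ℝ := ((N : ℝ) ^ L)⁻¹ with hε
    have hε0 : 0 < ε := by positivity
    have hε1 : ε ≤ 1 := inv_le_one_of_one_le₀ hN1
    have hδ : (((N : ℝ) ^ 2)⁻¹) ^ L = ε * ε := by
      rw [hε, inv_pow, ← pow_mul, mul_comm 2 L, pow_mul, pow_two, mul_inv]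
    rw [hδ, div_eq_mul_inv (8 ^ (s + 1)), show (8 : ℝ) = 4 * 2 by norm_num, mul_pow,
      mul_assoc (4 ^ (s + 1)) (2 ^ (s + 1))]
    refine mul_lt_mul_of_pos_left ?_ (by positivity)
    calc (s : ℝ) * (s + 2) * (ε * ε / 4) ≤ s * (s + 2) * (ε * 1 / 4) := by gcongr
      _ < 4 * 2 ^ (s + 1) * (ε * 1 / 4) := mul_lt_mul_of_pos_right hs' (by positivity)
      _ = 2 ^ (s + 1) * ε := by ring
end

section
/- For every d, s, N, L ∈ ℕ₊ there exists a composition TF₀ of feed-forward layers (a Transformer network all of whose attention layers are the identity map) of width at most 12·s·d^s·N and depth at most (s−1)(L+1) with the following property: on an input column vector whose first d entries are x = (x_1,…,x_d) ∈ [0,1]^d and whose remaining entries are 0, the output column of TF₀ contains, in designated coordinates indexed by the exponent vectors p ∈ ℕ^d with 1 ≤ |p| ≤ s, values ψ_p(x) satisfying |ψ_p(x) − x^p| ≤ (|p|−1)·N^{−L}; in particular the coordinates with |p| = 1 reproduce the entries of x exactly. -/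
open scoped Matrix

/-- Applying a composition of feed-forward layers (a Transformer network all of
whose attention layers are the identity map). -/
def applyFFNet {d : ℕ} (net : List (FFLayer d)) {n : ℕ}
    (X : Matrix (Fin d) (Fin n) ℝ) : Matrix (Fin d) (Fin n) ℝ :=
  net.foldl (fun Y F => F.apply Y) X

/-! ### Triangle waves and the interpolation of the square -/

/-- The residual `r - r²` of interpolating the square on a unit interval. -/
def bump (t : ℝ) : ℝ := t - t ^ 2

lemma bump_mem {t : ℝ} (ht : t ∈ Set.Icc (0 : ℝ) 1) : bump t ∈ Set.Icc (0 : ℝ) (1 / 4) := by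
  obtain ⟨h0, h1⟩ := ht
  constructor <;> unfold bump <;> nlinarith [sq_nonneg (t - 1 / 2)]

/-- ReLU coefficients of the triangle wave with `N` monotone pieces. -/
def waveCoeff (N k : ℕ) : ℝ := if k = 0 then N else 2 * N * (-1) ^ k

/-- ReLU coefficients of the interpolant of `bump` on the grid of mesh `1 / N`. -/
noncomputable def bumpCoeff (N k : ℕ) : ℝ := if k = 0 then 1 - 1 / N else -2 / N

/-- The piecewise linear function on `[0, ∞)` with knots `k / N` and slope increments `a k`. -/
noncomputable def reluSum (N : ℕ) (a : ℕ → ℝ) (t : ℝ) : ℝ :=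
  ∑ k : Fin N, a k * relu (t - (k : ℕ) / N)

lemma relu_of_nonneg {x : ℝ} (h : 0 ≤ x) : relu x = x := max_eq_right h

lemma relu_of_nonpos {x : ℝ} (h : x ≤ 0) : relu x = 0 := max_eq_left h

lemma exists_grid_cell {N : ℕ} (hN : 0 < N) {t : ℝ} (ht : t ∈ Set.Icc (0 : ℝ) 1) :
    ∃ k < N, ∃ r ∈ Set.Icc (0 : ℝ) 1, t = (k + r) / N := by
  have hN' : (0 : ℝ) < N := by exact_mod_cast hN
  obtain ⟨h0, h1⟩ := ht
  rcases h1.eq_or_lt with rfl | h1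
  · refine ⟨N - 1, by omega, 1, by simp, ?_⟩
    rw [Nat.cast_sub hN]
    field_simp
    simp
  · have hnn : 0 ≤ N * t := by positivity
    refine ⟨⌊N * t⌋₊, ?_, N * t - ⌊N * t⌋₊, ⟨?_, ?_⟩, ?_⟩
    · rw [Nat.floor_lt hnn]
      nlinarith
    · linarith [Nat.floor_le hnn]
    · linarith [Nat.lt_floor_add_one (N * t)]
    · field_simp
      ring

lemma reluSum_eq {N k : ℕ} (hk : k < N) {r : ℝ} (hr : r ∈ Set.Icc (0 : ℝ) 1) (a : ℕ → ℝ) :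
    reluSum N a ((k + r) / N) = ∑ i ∈ Finset.range (k + 1), a i * ((k + r - i) / N) := by
  have hN' : (0 : ℝ) < N := by exact_mod_cast (Nat.zero_le k).trans_lt hk
  obtain ⟨h0, h1⟩ := hr
  rw [reluSum, Fin.sum_univ_eq_sum_range (fun i => a i * relu ((k + r) / N - (i : ℕ) / N)),
    ← Finset.sum_range_add_sum_Ico _ (show k + 1 ≤ N from hk)]
  rw [Finset.sum_eq_zero (s := Finset.Ico (k + 1) N), add_zero]
  · refine Finset.sum_congr rfl fun i hi => ?_
    have hi : (i : ℝ) ≤ k := by exact_mod_cast Nat.lt_succ_iff.1 (Finset.mem_range.1 hi)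
    rw [← sub_div, relu_of_nonneg]
    exact div_nonneg (by linarith) hN'.le
  · intro i hi
    have hi : (k : ℝ) + 1 ≤ i := by exact_mod_cast (Finset.mem_Ico.1 hi).1
    rw [← sub_div, relu_of_nonpos, mul_zero]
    exact div_nonpos_of_nonpos_of_nonneg (by linarith) hN'.le

lemma sum_bumpCoeff {N : ℕ} (hN : 0 < N) (k : ℕ) (r : ℝ) :
    ∑ i ∈ Finset.range (k + 1), bumpCoeff N i * ((k + r - i) / N) =
      (k + r) / N - ((2 * k + 1) * (k + r) - k * (k + 1)) / N ^ 2 := by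
  have hN' : (N : ℝ) ≠ 0 := by exact_mod_cast hN.ne'
  induction k generalizing r with
  | zero => simp [bumpCoeff]; field_simp
  | succ k ih =>
    rw [Finset.sum_range_succ]
    have := ih (r + 1)
    push_cast
    simp only [add_assoc, add_comm r 1] at this ⊢
    rw [this]
    simp [bumpCoeff]
    field_simp
    ring

lemma sum_waveCoeff {N : ℕ} (hN : 0 < N) (k : ℕ) (r : ℝ) :
    ∑ i ∈ Finset.range (k + 1), waveCoeff N i * ((k + r - i) / N) =
      1 / 2 + (-1) ^ k * (r - 1 / 2) := by
  have hN' : (N : ℝ) ≠ 0 := by exact_mod_cast hN.ne'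
  induction k generalizing r with
  | zero => simp [waveCoeff]; field_simp
  | succ k ih =>
    rw [Finset.sum_range_succ]
    have := ih (r + 1)
    push_cast
    simp only [add_assoc, add_comm r 1] at this ⊢
    rw [this]
    simp [waveCoeff]
    field_simp
    ring

lemma reluSum_wave_mem {N : ℕ} (hN : 0 < N) {t : ℝ} (ht : t ∈ Set.Icc (0 : ℝ) 1) :
    reluSum N (waveCoeff N) t ∈ Set.Icc (0 : ℝ) 1 := by
  obtain ⟨k, hk, r, hr, rfl⟩ := exists_grid_cell hN ht
  rw [reluSum_eq hk hr, sum_waveCoeff hN]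
  obtain ⟨h0, h1⟩ := hr
  rcases neg_one_pow_eq_or ℝ k with h | h <;> rw [h] <;> constructor <;> linarith

/-- Self-similarity of `bump` under the triangle wave. -/
lemma bump_eq {N : ℕ} (hN : 0 < N) {t : ℝ} (ht : t ∈ Set.Icc (0 : ℝ) 1) :
    bump t = reluSum N (bumpCoeff N) t + bump (reluSum N (waveCoeff N) t) / N ^ 2 := by
  have hN' : (N : ℝ) ≠ 0 := by exact_mod_cast hN.ne'
  obtain ⟨k, hk, r, hr, rfl⟩ := exists_grid_cell hN ht
  rw [reluSum_eq hk hr, reluSum_eq hk hr, sum_waveCoeff hN, sum_bumpCoeff hN]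
  rcases neg_one_pow_eq_or ℝ k with h | h <;> rw [h] <;> unfold bump <;> field_simp <;> ring

lemma reluSum_wave_sub {N : ℕ} (hN : 0 < N) {t : ℝ} (ht : 0 ≤ t) :
    t + reluSum N (fun k => waveCoeff N k - if k = 0 then 1 else 0) t =
      reluSum N (waveCoeff N) t := by
  obtain ⟨M, rfl⟩ := Nat.exists_eq_succ_of_ne_zero hN.ne'
  simp [reluSum, Fin.sum_univ_succ, relu_of_nonneg ht]
  ring

/-! ### Sparse layers and reachable output properties -/

/-- A residual ReLU layer in which every hidden unit reads a single coordinate. -/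
def sparseStep {ι κ : Type*} [Fintype κ] (W : ι → κ → ℝ) (src : κ → ι) (b : κ → ℝ)
    (v : ι → ℝ) : ι → ℝ :=
  fun i => v i + ∑ j, W i j * relu (v (src j) - b j)

/-- The feed-forward layer realizing `sparseStep` in the coordinates given by `e`. -/
noncomputable def sparseLayer {ι κ : Type*} [Fintype κ] {D : ℕ} (e : ι ≃ Fin D)
    (W : ι → κ → ℝ) (src : κ → ι) (b : κ → ℝ) : FFLayer D where
  r := Fintype.card κ
  W1 := Matrix.of fun a i => if i = e (src ((Fintype.equivFin κ).symm a)) then 1 else 0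
  W2 := Matrix.of fun i a => W (e.symm i) ((Fintype.equivFin κ).symm a)
  b1 := fun a => -b ((Fintype.equivFin κ).symm a)
  b2 := 0

lemma sparseLayer_apply {ι κ : Type*} [Fintype κ] {D : ℕ} (e : ι ≃ Fin D)
    (W : ι → κ → ℝ) (src : κ → ι) (b : κ → ℝ) (X : Matrix (Fin D) (Fin 1) ℝ) (i : ι) :
    (sparseLayer e W src b).apply X (e i) 0 =
      sparseStep W src b (fun i => X (e i) 0) i := by
  change X (e i) 0 + (∑ a : Fin (Fintype.card κ), W (e.symm (e i)) ((Fintype.equivFin κ).symm a) *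
    relu (∑ i', (if i' = e (src ((Fintype.equivFin κ).symm a)) then 1 else 0) * X i' 0 +
      -b ((Fintype.equivFin κ).symm a))) + 0 = _
  simp only [add_zero, Equiv.symm_apply_apply, ite_mul, one_mul, zero_mul,
    Finset.sum_ite_eq', Finset.mem_univ, if_true, ← sub_eq_add_neg]
  unfold sparseStep
  congr 1
  exact Equiv.sum_comp (Fintype.equivFin κ).symm
    (fun j => W i j * relu (X (e (src j)) 0 - b j))

/-- Some network of depth `n` and inner width at most `R`, run on any `x ∈ [0,1]^d`, ends in a
state satisfying `Q x`. -/
def Reach {ι : Type*} {D d : ℕ} (e : ι ≃ Fin D) (R n : ℕ)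
    (Q : (Fin d → ℝ) → (ι → ℝ) → Prop) : Prop :=
  ∃ net : List (FFLayer D), (∀ F ∈ net, F.r ≤ R) ∧ net.length = n ∧
    ∀ x : Fin d → ℝ, (∀ i, x i ∈ Set.Icc (0 : ℝ) 1) →
      Q x fun i => applyFFNet net (embed D 1 (Matrix.of fun i (_ : Fin 1) => x i)) (e i) 0

lemma Reach.step {ι κ : Type*} [Fintype κ] {D d : ℕ} {e : ι ≃ Fin D} {R n : ℕ}
    {Q Q' : (Fin d → ℝ) → (ι → ℝ) → Prop} (h : Reach e R n Q)
    (W : ι → κ → ℝ) (src : κ → ι) (b : κ → ℝ) (hR : Fintype.card κ ≤ R)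
    (hQ : ∀ x v, (∀ i, x i ∈ Set.Icc (0 : ℝ) 1) → Q x v → Q' x (sparseStep W src b v)) :
    Reach e R (n + 1) Q' := by
  obtain ⟨net, hr, hl, hx⟩ := h
  refine ⟨net ++ [sparseLayer e W src b], ?_, by simp [hl], fun x h01 => ?_⟩
  · intro F hF
    rcases List.mem_append.1 hF with hF | hF
    · exact hr F hF
    · rw [List.mem_singleton.1 hF]
      exact hR
  · have := hQ x _ h01 (hx x h01)
    simpa only [applyFFNet, List.foldl_append, List.foldl_cons, List.foldl_nil,
      sparseLayer_apply] using this

lemma Reach.mono {ι : Type*} {D d : ℕ} {e : ι ≃ Fin D} {R n : ℕ}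
    {Q Q' : (Fin d → ℝ) → (ι → ℝ) → Prop} (h : Reach e R n Q)
    (hQ : ∀ x v, (∀ i, x i ∈ Set.Icc (0 : ℝ) 1) → Q x v → Q' x v) : Reach e R n Q' := by
  obtain ⟨net, hr, hl, hx⟩ := h
  exact ⟨net, hr, hl, fun x h01 => hQ x _ h01 (hx x h01)⟩

/-! ### The multiplication stages -/

/-- The coordinates used by the network: the inputs, and for each node `(k, f)`, which carries
the product of `x (f 0), …, x (f (k + 1))`, an output slot `none` and three scratch slots. -/
abbrev Coord (d m : ℕ) : Type :=
  Fin d ⊕ ((Fin m × (Fin (m + 1) → Fin d)) × Option (Fin 3))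

/-- The product of the first `k` factors selected by `f`. -/
def partialProd {d m : ℕ} (x : Fin d → ℝ) (f : Fin (m + 1) → Fin d) (k : ℕ) : ℝ :=
  ∏ i ∈ Finset.range k, x (f (Fin.ofNat (m + 1) i))

/-- The coordinate carrying the product of the first `k + 1` factors selected by `f`. -/
def prodCoord {d m : ℕ} (f : Fin (m + 1) → Fin d) : (k : ℕ) → k ≤ m → Coord d m
  | 0, _ => .inl (f 0)
  | k + 1, h => .inr ((⟨k, h⟩, f), none)

/-- Weights of hidden units that act blockwise, the block of `f` writing into the slots of the
node `(k, f)` only. -/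
def blockWeight {d m : ℕ} {κ : Type*} (k : Fin m) (w : Option (Fin 3) → κ → ℝ) :
    Coord d m → (Fin (m + 1) → Fin d) × κ → ℝ
  | .inl _, _ => 0
  | .inr ((k', f'), c), (f, j) => if k' = k ∧ f = f' then w c j else 0

section block

variable {d m : ℕ} {κ : Type*} [Fintype κ] (k : Fin m) (w : Option (Fin 3) → κ → ℝ)
  (src : (Fin (m + 1) → Fin d) × κ → Coord d m) (b : (Fin (m + 1) → Fin d) × κ → ℝ)
  (v : Coord d m → ℝ)

lemma sparseStep_block_inl (i : Fin d) :
    sparseStep (blockWeight k w) src b v (.inl i) = v (.inl i) := by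
  simp [sparseStep, blockWeight]

lemma sparseStep_block_of_ne {k' : Fin m} (h : k' ≠ k) (f : Fin (m + 1) → Fin d)
    (c : Option (Fin 3)) :
    sparseStep (blockWeight k w) src b v (.inr ((k', f), c)) = v (.inr ((k', f), c)) := by
  simp [sparseStep, blockWeight, h]

lemma sparseStep_block (f : Fin (m + 1) → Fin d) (c : Option (Fin 3)) :
    sparseStep (blockWeight k w) src b v (.inr ((k, f), c)) =
      v (.inr ((k, f), c)) + ∑ j, w c j * relu (v (src (f, j)) - b (f, j)) := by
  simp only [sparseStep, blockWeight, true_and, Fintype.sum_prod_type, ite_mul, zero_mul]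
  congr 1
  rw [Finset.sum_eq_single f] <;> simp +contextual

end block

/-- The state after `n` multiplication stages, with error `ε` per stage. -/
structure Done {d m : ℕ} (ε : ℝ) (n : ℕ) (x : Fin d → ℝ) (v : Coord d m → ℝ) : Prop where
  input : ∀ i, v (.inl i) = x i
  out : ∀ k : Fin m, (k : ℕ) < n → ∀ f,
    |v (.inr ((k, f), none)) - partialProd x f (k + 2)| ≤ ((k : ℕ) + 1) * ε
  rest : ∀ k : Fin m, n ≤ (k : ℕ) → ∀ f c, v (.inr ((k, f), c)) = 0

lemma Done.prodCoord {d m : ℕ} {ε : ℝ} {n : ℕ} {x : Fin d → ℝ} {v : Coord d m → ℝ}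
    (h : Done ε n x v) (f : Fin (m + 1) → Fin d) (k : ℕ) (hk : k ≤ m) (hkn : k ≤ n) :
    |v (prodCoord f k hk) - partialProd x f (k + 1)| ≤ k * ε := by
  cases k with
  | zero => simp [_root_.prodCoord, partialProd, h.input]
  | succ k => simpa [_root_.prodCoord] using h.out ⟨k, hk⟩ hkn f

/-- The coefficients with which the three bumps enter a product. -/
noncomputable def bumpWeight : Fin 3 → ℝ := ![-2, 1 / 2, 1 / 2]

/-- The state inside stage `n`, with `j` refinement layers applied. -/
structure Busy {d m : ℕ} (ε : ℝ) (N : ℕ) (n : Fin m) (j : ℕ) (x : Fin d → ℝ)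
    (v : Coord d m → ℝ) : Prop where
  input : ∀ i, v (.inl i) = x i
  out : ∀ k : Fin m, k < n → ∀ f,
    |v (.inr ((k, f), none)) - partialProd x f (k + 2)| ≤ ((k : ℕ) + 1) * ε
  rest : ∀ k : Fin m, n < k → ∀ f c, v (.inr ((k, f), c)) = 0
  scratch : ∀ f c, v (.inr ((n, f), some c)) ∈ Set.Icc (0 : ℝ) 1
  acc : ∀ f, |v (.inr ((n, f), none)) +
      ∑ c, bumpWeight c * bump (v (.inr ((n, f), some c))) / (N : ℝ) ^ (2 * j) -
      partialProd x f (n + 2)| ≤ (n : ℕ) * ε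

/-- Truncation to `[0, 1]` as a difference of two ReLUs. -/
lemma relu_sub_relu (y : ℝ) : relu y - relu (y - 1) = max 0 (min y 1) := by
  unfold relu
  rcases le_total y 0 with h | h <;> rcases le_total y 1 with h' | h' <;>
    simp [h, h'] <;> linarith

lemma partialProd_mem {d m : ℕ} {x : Fin d → ℝ} (hx : ∀ i, x i ∈ Set.Icc (0 : ℝ) 1)
    (f : Fin (m + 1) → Fin d) (k : ℕ) : partialProd x f k ∈ Set.Icc (0 : ℝ) 1 :=
  ⟨Finset.prod_nonneg fun _ _ => (hx _).1,
    Finset.prod_le_one (fun _ _ => (hx _).1) fun _ _ => (hx _).2⟩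

lemma abs_truncate_sub_le {y p : ℝ} (hp : p ∈ Set.Icc (0 : ℝ) 1) :
    |max 0 (min y 1) - p| ≤ |y - p| := by
  obtain ⟨h0, h1⟩ := hp
  rcases le_total y 0 with h | h <;> rcases le_total y 1 with h' | h' <;>
    simp [h, h']
  all_goals cases abs_cases (y - p) <;> rw [abs_le] <;> constructor <;> linarith

/-- Weights of the layer that opens a multiplication stage. -/
noncomputable def openWeight : Option (Fin 3) → Fin 3 → ℝ
  | none => ![1 / 2, -1 / 2, 1 / 2]
  | some c => ![![1 / 2, -1 / 2, 1 / 2], ![1, -1, 0], ![0, 0, 1]] c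

lemma Reach.busy {d m N : ℕ} {D R n : ℕ} {ε : ℝ} {e : Coord d m ≃ Fin D} (k : Fin m)
    (hR : Fintype.card ((Fin (m + 1) → Fin d) × Fin 3) ≤ R)
    (h : Reach e R n (Done (d := d) ε k)) : Reach e R (n + 1) (Busy (d := d) ε N k 0) := by
  refine h.step (κ := (Fin (m + 1) → Fin d) × Fin 3) (blockWeight k openWeight)
    (fun fj => ![prodCoord fj.1 k k.2.le, prodCoord fj.1 k k.2.le,
      .inl (fj.1 (Fin.ofNat (m + 1) (k + 1)))] fj.2)
    (fun fj => ![0, 1, 0] fj.2) hR fun x v hx hv => ?_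
  have key : ∀ f : Fin (m + 1) → Fin d, ∃ a y : ℝ, a ∈ Set.Icc (0 : ℝ) 1 ∧ y ∈ Set.Icc (0 : ℝ) 1 ∧
      y = x (f (Fin.ofNat (m + 1) (k + 1))) ∧
      |a - partialProd x f (k + 1)| ≤ (k : ℕ) * ε ∧
      a = relu (v (prodCoord f k k.2.le)) - relu (v (prodCoord f k k.2.le) - 1) := fun f =>
    ⟨_, _, ⟨le_max_left 0 (min (v (prodCoord f k k.2.le)) 1), max_le zero_le_one (min_le_right _ _)⟩,
      hx _, rfl,
      (abs_truncate_sub_le (partialProd_mem hx _ _)).trans (hv.prodCoord f k k.2.le le_rfl),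
      (relu_sub_relu _).symm⟩
  refine ⟨?_, ?_, ?_, ?_, ?_⟩
  · intro i
    rw [sparseStep_block_inl, hv.input]
  · intro k' hk' f
    rw [sparseStep_block_of_ne _ _ _ _ _ hk'.ne]
    exact hv.out k' hk' f
  · intro k' hk' f c
    rw [sparseStep_block_of_ne _ _ _ _ _ hk'.ne']
    exact hv.rest k' (le_of_lt hk') f c
  · intro f c
    obtain ⟨a, y, ⟨ha0, ha1⟩, ⟨hy0, hy1⟩, hy, -, ha⟩ := key f
    rw [Fin.ofNat_eq_cast] at hy
    rw [sparseStep_block, hv.rest k le_rfl]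
    fin_cases c <;>
      simp [openWeight, Fin.sum_univ_three, hv.input, ← hy, relu_of_nonneg hy0] <;>
      constructor <;> linarith
  · intro f
    obtain ⟨a, y, ⟨ha0, ha1⟩, ⟨hy0, hy1⟩, hy, hap, ha⟩ := key f
    have hmul : |a * y - partialProd x f (k + 1) * y| ≤ (k : ℕ) * ε := by
      rw [← sub_mul, abs_mul, abs_of_nonneg hy0]
      exact (mul_le_of_le_one_right (abs_nonneg _) hy1).trans hap
    have hp : partialProd x f (k + 2) = partialProd x f (k + 1) * y := by
      rw [partialProd, Finset.prod_range_succ, hy]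
      rfl
    rw [hp]
    rw [Fin.ofNat_eq_cast] at hy
    refine le_of_eq_of_le ?_ hmul
    congr 2
    simp only [sparseStep_block, hv.rest k le_rfl, Fin.sum_univ_three, bumpWeight, openWeight]
    simp [hv.input, ← hy, relu_of_nonneg hy0, bump]
    generalize relu (v (prodCoord f k k.2.le)) = p at ha ⊢
    generalize relu (v (prodCoord f k k.2.le) - 1) = q at ha ⊢
    subst ha
    ring

/-- Weights of a refinement layer, which replaces every scratch value by its triangle wave and
adds the interpolants of the bumps to the output. -/
noncomputable def refineWeight (N j : ℕ) : Option (Fin 3) → Fin 3 × Fin N → ℝ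
  | none, (c, i) => bumpWeight c / (N : ℝ) ^ (2 * j) * bumpCoeff N i
  | some c', (c, i) => if c = c' then waveCoeff N i - if (i : ℕ) = 0 then 1 else 0 else 0

lemma Reach.refine {d m N : ℕ} (hN : 0 < N) {D R n j : ℕ} {ε : ℝ} {e : Coord d m ≃ Fin D}
    (k : Fin m) (hR : Fintype.card ((Fin (m + 1) → Fin d) × Fin 3 × Fin N) ≤ R)
    (h : Reach e R n (Busy (d := d) ε N k j)) :
    Reach e R (n + 1) (Busy (d := d) ε N k (j + 1)) := by
  refine h.step (κ := (Fin (m + 1) → Fin d) × Fin 3 × Fin N) (blockWeight k (refineWeight N j))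
    (fun fj => .inr ((k, fj.1), some fj.2.1)) (fun fj => (fj.2.2 : ℕ) / N) hR
    fun x v hx hv => ?_
  have hsome : ∀ f c, sparseStep (blockWeight k (refineWeight N j))
      (fun fj => .inr ((k, fj.1), some fj.2.1)) (fun fj => (fj.2.2 : ℕ) / N) v
      (.inr ((k, f), some c)) = reluSum N (waveCoeff N) (v (.inr ((k, f), some c))) := by
    intro f c
    rw [sparseStep_block, ← reluSum_wave_sub hN (hv.scratch f c).1]
    simp only [refineWeight, Fintype.sum_prod_type, ite_mul, zero_mul, reluSum]
    congr 1
    rw [Finset.sum_eq_single c] <;> simp +contextual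
  have hnone : ∀ f, sparseStep (blockWeight k (refineWeight N j))
      (fun fj => .inr ((k, fj.1), some fj.2.1)) (fun fj => (fj.2.2 : ℕ) / N) v
      (.inr ((k, f), none)) = v (.inr ((k, f), none)) +
        ∑ c, bumpWeight c / (N : ℝ) ^ (2 * j) *
          reluSum N (bumpCoeff N) (v (.inr ((k, f), some c))) := by
    intro f
    rw [sparseStep_block]
    simp only [refineWeight, Fintype.sum_prod_type, reluSum, Finset.mul_sum, mul_assoc]
  refine ⟨?_, ?_, ?_, ?_, ?_⟩
  · intro i
    rw [sparseStep_block_inl, hv.input]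
  · intro k' hk' f
    rw [sparseStep_block_of_ne _ _ _ _ _ hk'.ne]
    exact hv.out k' hk' f
  · intro k' hk' f c
    rw [sparseStep_block_of_ne _ _ _ _ _ hk'.ne']
    exact hv.rest k' hk' f c
  · intro f c
    rw [hsome]
    exact reluSum_wave_mem hN (hv.scratch f c)
  · intro f
    refine le_of_eq_of_le ?_ (hv.acc f)
    congr 2
    simp only [hsome, hnone]
    rw [add_assoc, ← Finset.sum_add_distrib]
    congr 1
    refine Finset.sum_congr rfl fun c _ => ?_
    rw [bump_eq hN (hv.scratch f c)]
    have hN' : (N : ℝ) ≠ 0 := by exact_mod_cast hN.ne'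
    field_simp
    ring

lemma Busy.done {d m N L : ℕ} (hN : 0 < N) {k : Fin m} {x : Fin d → ℝ} {v : Coord d m → ℝ}
    (h : Busy (1 / (N : ℝ) ^ L) N k L x v) : Done (1 / (N : ℝ) ^ L) (k + 1) x v := by
  refine ⟨h.input, ?_, fun k' hk' f c => h.rest k' hk' f c⟩
  intro k' hk' f
  rcases (Nat.lt_succ_iff.1 hk').eq_or_lt with hk' | hk'
  · obtain rfl := Fin.ext hk'
    have hacc := h.acc f
    rw [← Finset.sum_div, Fin.sum_univ_three] at hacc
    obtain ⟨p0, q0⟩ := bump_mem (h.scratch f 0)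
    obtain ⟨p1, q1⟩ := bump_mem (h.scratch f 1)
    obtain ⟨p2, q2⟩ := bump_mem (h.scratch f 2)
    generalize bump (v (.inr ((k', f), some 0))) = g0 at *
    generalize bump (v (.inr ((k', f), some 1))) = g1 at *
    generalize bump (v (.inr ((k', f), some 2))) = g2 at *
    have hN1 : (1 : ℝ) ≤ (N : ℝ) ^ L := one_le_pow₀ (by exact_mod_cast hN)
    set S := bumpWeight 0 * g0 + bumpWeight 1 * g1 + bumpWeight 2 * g2 with hS
    have hS1 : |S| ≤ 1 := by
      rw [hS, abs_le]
      simp only [bumpWeight, Matrix.cons_val]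
      constructor <;> linarith
    have hSN : |S / (N : ℝ) ^ (2 * L)| ≤ 1 / (N : ℝ) ^ L := by
      rw [abs_div, abs_of_nonneg (a := (N : ℝ) ^ (2 * L)) (by positivity)]
      gcongr
      · exact_mod_cast hN
      · omega
    rw [abs_le] at hacc hSN ⊢
    constructor <;> linarith [hacc.1, hacc.2, hSN.1, hSN.2]
  · exact h.out k' hk' f

lemma reach_done {d m N L : ℕ} (hN : 0 < N) {D R : ℕ} {e : Coord d m ≃ Fin D}
    (hR : (d ^ (m + 1)) * (3 * N) ≤ R)
    (h0 : Reach e R 0 (Done (d := d) (1 / (N : ℝ) ^ L) 0)) (n : ℕ) (hn : n ≤ m) :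
    Reach e R (n * (L + 1)) (Done (d := d) (1 / (N : ℝ) ^ L) n) := by
  induction n with
  | zero => simpa using h0
  | succ n ih =>
    have hR3 : Fintype.card ((Fin (m + 1) → Fin d) × Fin 3) ≤ R := by
      simp only [Fintype.card_prod, Fintype.card_fun, Fintype.card_fin]
      exact (Nat.mul_le_mul_left _ (by omega)).trans hR
    have hbusy : ∀ j, Reach e R (n * (L + 1) + 1 + j)
        (Busy (d := d) (1 / (N : ℝ) ^ L) N ⟨n, hn⟩ j) := by
      intro j
      induction j with
      | zero => exact (ih (by omega)).busy ⟨n, hn⟩ hR3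
      | succ j ihj =>
        refine ihj.refine hN ⟨n, hn⟩ ?_
        simpa using hR
    have := (hbusy L).mono fun x v _ hv => hv.done hN
    convert this using 1
    ring

/-! ### Exponent vectors and the main theorem -/

lemma exists_partialProd_eq {d m : ℕ} (p : Fin d → ℕ) (h1 : 1 ≤ ∑ i, p i)
    (hm : ∑ i, p i ≤ m + 1) :
    ∃ f : Fin (m + 1) → Fin d, ∀ x : Fin d → ℝ,
      partialProd x f (∑ i, p i) = ∏ i, x i ^ p i := by
  let l : List (Fin d) := (∑ i, Multiset.replicate (p i) i).toList
  have hl : l.length = ∑ i, p i := by simp [l]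
  refine ⟨fun i => l.getD i (l.get ⟨0, by omega⟩), fun x => ?_⟩
  have hprod : ∏ i, x i ^ p i = (l.map x).prod := by
    rw [← Multiset.prod_coe, ← Multiset.map_coe, Multiset.coe_toList]
    change _ = (Multiset.mapAddMonoidHom x _).prod
    rw [map_sum, Multiset.prod_sum]
    simp
  rw [hprod, partialProd, ← hl, ← Fin.prod_univ_fun_getElem, ← Fin.prod_univ_eq_prod_range
    (fun i => x (l.getD (Fin.ofNat (m + 1) i : ℕ) (l.get ⟨0, by omega⟩)))]
  refine Finset.prod_congr rfl fun i _ => ?_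
  have hi : (i : ℕ) % (m + 1) = i := Nat.mod_eq_of_lt (by omega)
  simp [Fin.ofNat, hi]

/-- The identification of `Coord d m` with an initial segment of `ℕ` that puts the inputs
first. -/
noncomputable def coordEquiv (d m : ℕ) :
    Coord d m ≃ Fin (d + Fintype.card ((Fin m × (Fin (m + 1) → Fin d)) × Option (Fin 3))) :=
  (Equiv.sumCongr (Equiv.refl _) (Fintype.equivFin _)).trans finSumFinEquiv

lemma reach_zero (d m R : ℕ) (ε : ℝ) : Reach (coordEquiv d m) R 0 (Done (d := d) ε 0) := by
  refine ⟨[], by simp, rfl, fun x _ => ⟨fun i => ?_, fun k hk => absurd hk (Nat.not_lt_zero _),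
    fun k _ f c => ?_⟩⟩ <;> simp [applyFFNet, embed, coordEquiv]

/-- There is a composition `TF₀` of feed-forward layers of width at most
`12·s·d^s·N` and depth at most `(s−1)(L+1)` which, on an input column whose first
`d` entries are `x ∈ [0,1]^d` and whose remaining entries are `0`, produces in
designated coordinates (indexed by the exponent vectors `p` with `1 ≤ |p| ≤ s`)
values approximating the monomials `x^p` with error at most `(|p|−1)·N^{−L}`;
the coordinates with `|p| = 1` reproduce the entries of `x` exactly. -/
theorem stmt1 (d s N L : ℕ) (hd : 0 < d) (hs : 0 < s) (hN : 0 < N) (hL : 0 < L) :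
    ∃ (d' : ℕ) (net : List (FFLayer d')) (idx : (Fin d → ℕ) → Fin d'),
      d' ≤ 12 * s * d^s * N ∧
      (∀ F ∈ net, F.r ≤ 12 * s * d^s * N) ∧
      net.length ≤ (s-1)*(L+1) ∧
      ∀ x : Fin d → ℝ, (∀ i, x i ∈ Set.Icc (0:ℝ) 1) →
        (∀ p : Fin d → ℕ, 1 ≤ ∑ i, p i → (∑ i, p i) ≤ s →
          |applyFFNet net (embed d' 1 (Matrix.of fun i (_ : Fin 1) => x i)) (idx p) 0 -
              ∏ i, x i ^ p i| ≤ (((∑ i, p i : ℕ) : ℝ) - 1) / (N : ℝ)^L) ∧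
        (∀ p : Fin d → ℕ, (∑ i, p i) = 1 →
          applyFFNet net (embed d' 1 (Matrix.of fun i (_ : Fin 1) => x i)) (idx p) 0 =
            ∏ i, x i ^ p i) := by
  obtain ⟨m, rfl⟩ : ∃ m, s = m + 1 := ⟨s - 1, by omega⟩
  have hpos : 0 < d ^ (m + 1) := by positivity
  obtain ⟨net, hr, hl, hx⟩ := reach_done (L := L) (R := 12 * (m + 1) * d ^ (m + 1) * N) hN
    (by nlinarith [Nat.zero_le (m * (d ^ (m + 1) * N)), Nat.zero_le (d ^ (m + 1) * N)])
    (reach_zero d m _ _) m le_rfl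
  have hidx : ∀ p : Fin d → ℕ, ∃ c : Coord d m, 1 ≤ ∑ i, p i → ∑ i, p i ≤ m + 1 →
      ∀ (x : Fin d → ℝ) (v : Coord d m → ℝ), Done (1 / (N : ℝ) ^ L) m x v →
        |v c - ∏ i, x i ^ p i| ≤ (((∑ i, p i : ℕ) : ℝ) - 1) / (N : ℝ) ^ L := by
    intro p
    by_cases hp : 1 ≤ ∑ i, p i ∧ ∑ i, p i ≤ m + 1
    · obtain ⟨f, hf⟩ := exists_partialProd_eq p hp.1 hp.2
      refine ⟨prodCoord f (∑ i, p i - 1) (by omega), fun h1 h2 x v hv => ?_⟩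
      have := hv.prodCoord f (∑ i, p i - 1) (by omega) (by omega)
      rw [Nat.sub_add_cancel h1, hf, Nat.cast_sub h1] at this
      simpa [div_eq_mul_inv] using this
    · exact ⟨.inl ⟨0, hd⟩, fun h1 h2 => absurd ⟨h1, h2⟩ hp⟩
  choose idx hidx using hidx
  refine ⟨_, net, fun p => coordEquiv d m (idx p), ?_, hr, hl.le, fun x h01 => ⟨?_, ?_⟩⟩
  · simp only [Fintype.card_prod, Fintype.card_fun, Fintype.card_fin, Fintype.card_option]
    have hdle : d ≤ d ^ (m + 1) := Nat.le_self_pow (by omega) d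
    calc d + m * d ^ (m + 1) * (3 + 1) ≤ 12 * (m + 1) * d ^ (m + 1) * 1 := by
          nlinarith [Nat.zero_le (m * d ^ (m + 1))]
      _ ≤ _ := Nat.mul_le_mul_left _ hN
  · intro p h1 h2
    exact hidx p h1 h2 x _ (hx x h01)
  · intro p h1
    have := hidx p h1.ge (by omega) x _ (hx x h01)
    rw [h1] at this
    simpa [sub_eq_zero] using this
end
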